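/- For each d in the set {−291220, −633352, −874680, −731867, −507140, −578847, −167064, −296407, −317747, −401603, −588027, −591412, −803591, −835707, −999704}, the 3-primary part (the Sylow 3-subgroup) of the ideal class group of the ring of integers of the imaginary quadratic field ℚ(√d) is isomorphic to C3 × C3; equivalently, the 3-class group Cl₃(ℚ(√d)) is elementary abelian of rank two and order 9. -/

import Mathlib

/-- The value `N(ω + k) = k² + εk + n` for a root `ω` of `X² - εX + n`. -/
def quadVal (ε n k : ℤ) : ℤ := k * k + ε * k + n

/-- `R` is the maximal order `ℤ ⊕ ℤω` of an imaginary quadratic field, where `ω² = εω - n`. -/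
structure IsImagQuadOrder {R : Type*} [CommRing R] (ω : R) (ε n : ℤ) : Prop where
  sq_eq : ω * ω = ε * ω - n
  exists_eq : ∀ x : R, ∃ u v : ℤ, x = u + v * ω
  indep : ∀ u v : ℤ, (u : R) + v * ω = 0 → u = 0 ∧ v = 0
  disc_neg : ε * ε - 4 * n < 0
  fundamental : ∀ q : ℕ, q.Prime → ∀ k : ℤ,
    (q : ℤ) * q ∣ quadVal ε n k → ¬ (q : ℤ) ∣ 2 * k + ε

/-- The ideal `(a, ω + k)`. -/
def quadIdeal {R : Type*} [CommRing R] (ω : R) (a k : ℤ) : Ideal R :=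
  Ideal.span {(a : R), ω + k}

open Classical in
/-- The ideal class of `(a, ω + k)`. -/
noncomputable def quadClass {R : Type*} [CommRing R] [IsDedekindDomain R] (ω : R) (a k : ℤ) :
    ClassGroup R :=
  if h : quadIdeal ω a k = ⊥ then 1
  else ClassGroup.mk0 ⟨quadIdeal ω a k, mem_nonZeroDivisors_of_ne_zero h⟩

theorem quadVal_pos {ε n : ℤ} (h : ε * ε - 4 * n < 0) (k : ℤ) : 0 < quadVal ε n k := by
  unfold quadVal
  nlinarith [sq_nonneg (2 * k + ε)]

theorem quadVal_conj (ε n k : ℤ) : quadVal ε n (-k - ε) = quadVal ε n k := by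
  unfold quadVal
  ring

theorem dvd_quadVal_of_dvd_sub {ε n a k l : ℤ} (h : a ∣ quadVal ε n k) (hkl : a ∣ l - k) :
    a ∣ quadVal ε n l := by
  have e : quadVal ε n l = quadVal ε n k + (l - k) * (l + k + ε) := by unfold quadVal; ring
  rw [e]
  exact dvd_add h (hkl.mul_right _)

namespace IsImagQuadOrder

section Basic

variable {R : Type*} [CommRing R] {ω : R} {ε n : ℤ}

theorem intCast_ne_zero (h : IsImagQuadOrder ω ε n) {a : ℤ} (ha : a ≠ 0) : (a : R) ≠ 0 := by
  intro e
  exact ha (h.indep a 0 (by simp [e])).1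

theorem eq_of_eq (h : IsImagQuadOrder ω ε n) {u v u' v' : ℤ}
    (e : (u : R) + v * ω = u' + v' * ω) : u = u' ∧ v = v' := by
  have := h.indep (u - u') (v - v') (by push_cast; linear_combination e)
  omega

theorem mul_conj (h : IsImagQuadOrder ω ε n) (k : ℤ) :
    (ω + k) * (ε - ω + k) = (quadVal ε n k : ℤ) := by
  unfold quadVal
  push_cast
  linear_combination -h.sq_eq

theorem quadIdeal_ne_bot (h : IsImagQuadOrder ω ε n) {a : ℤ} (ha : a ≠ 0) (k : ℤ) :
    quadIdeal ω a k ≠ ⊥ := by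
  intro e
  have : (a : R) ∈ quadIdeal ω a k := Ideal.subset_span (by simp)
  rw [e] at this
  exact h.intCast_ne_zero ha (by simpa using this)

theorem quadIdeal_congr (ω : R) {a k l : ℤ} (hkl : a ∣ l - k) :
    quadIdeal ω a k = quadIdeal ω a l := by
  obtain ⟨t, ht⟩ := hkl
  have hl : (l : R) = k + a * t := by
    have : l = k + a * t := by linarith
    rw [this]; push_cast; ring
  unfold quadIdeal
  rw [hl, ← add_assoc, mul_comm (a : R), Ideal.span_pair_add_mul_left]

theorem quadIdeal_mul (h : IsImagQuadOrder ω ε n) {a b k : ℤ} (hab : a * b ∣ quadVal ε n k)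
    {x y z : ℤ} (hz : a * x + b * y + (2 * k + ε) * z = 1) :
    quadIdeal ω a k * quadIdeal ω b k = quadIdeal ω (a * b) k := by
  obtain ⟨c, hc⟩ := hab
  have hsq : (ω + k) * (ω + k) = (2 * k + ε) * (ω + k) - a * b * c := by
    have := congrArg (Int.cast : ℤ → R) hc
    unfold quadVal at this
    push_cast at this
    linear_combination h.sq_eq - this
  have hz' := congrArg (Int.cast : ℤ → R) hz
  push_cast at hz'
  unfold quadIdeal
  rw [Ideal.span_pair_mul_span_pair]
  apply le_antisymm
  · rw [Ideal.span_le]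
    rintro w (rfl | rfl | rfl | rfl) <;> rw [SetLike.mem_coe, Ideal.mem_span_pair]
    · exact ⟨1, 0, by push_cast; ring⟩
    · exact ⟨0, a, by ring⟩
    · exact ⟨0, b, by ring⟩
    · exact ⟨-c, 2 * k + ε, by push_cast; linear_combination -hsq⟩
  · rw [Ideal.span_le]
    have hm : ∀ w ∈ ({(a : R) * b, a * (ω + k), (ω + k) * b, (ω + k) * (ω + k)} : Set R),
        w ∈ Ideal.span ({(a : R) * b, a * (ω + k), (ω + k) * b, (ω + k) * (ω + k)} : Set R) :=
      fun w hw => Ideal.subset_span hw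
    generalize Ideal.span ({(a : R) * b, a * (ω + k), (ω + k) * b, (ω + k) * (ω + k)} : Set R) = J
      at hm
    simp only [Set.mem_insert_iff, Set.mem_singleton_iff, forall_eq_or_imp, forall_eq] at hm
    obtain ⟨m1, m2, m3, m4⟩ := hm
    rintro w (rfl | rfl)
    · simpa using m1
    · have e : ω + k = x * (a * (ω + k)) + y * ((ω + k) * b) +
          z * ((ω + k) * (ω + k) + c * (a * b)) := by
        linear_combination (-(ω + k)) * hz' - z * hsq
      exact (congrArg (· ∈ J) e).mpr
        (add_mem (add_mem (Ideal.mul_mem_left _ _ m2) (Ideal.mul_mem_left _ _ m3))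
        (Ideal.mul_mem_left _ _ (add_mem m4 (Ideal.mul_mem_left _ _ m1))))

theorem exists_of_mem_quadIdeal (h : IsImagQuadOrder ω ε n) {a k : ℤ}
    (hak : a ∣ quadVal ε n k) {x : R} (hx : x ∈ quadIdeal ω a k) :
    ∃ w v : ℤ, x = (k * v + a * w : ℤ) + v * ω := by
  obtain ⟨c, hc⟩ := hak
  unfold quadIdeal at hx
  obtain ⟨s, t, rfl⟩ := Ideal.mem_span_pair.mp hx
  obtain ⟨u, v, rfl⟩ := h.exists_eq s
  obtain ⟨u', v', rfl⟩ := h.exists_eq t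
  have := congrArg (Int.cast : ℤ → R) hc
  unfold quadVal at this
  push_cast at this
  refine ⟨u - k * v - c * v', a * v + u' + v' * (ε + k), ?_⟩
  push_cast
  linear_combination v' * h.sq_eq - v' * this

theorem gcd_eq_one (h : IsImagQuadOrder ω ε n) {a b k : ℤ} (hab : a * b ∣ quadVal ε n k) :
    Int.gcd (Int.gcd a b) (2 * k + ε) = 1 := by
  by_contra hg
  obtain ⟨q, hq, hqd⟩ := Nat.exists_prime_and_dvd hg
  have hq' : (q : ℤ) ∣ Int.gcd (Int.gcd a b) (2 * k + ε) := by exact_mod_cast hqd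
  have h1 : (q : ℤ) ∣ Int.gcd a b := hq'.trans (Int.gcd_dvd_left ..)
  exact h.fundamental q hq k
    ((mul_dvd_mul (h1.trans (Int.gcd_dvd_left ..)) (h1.trans (Int.gcd_dvd_right ..))).trans hab)
    (hq'.trans (Int.gcd_dvd_right ..))

theorem exists_nat_mem (h : IsImagQuadOrder ω ε n) {I : Ideal R} (hI : I ≠ ⊥) :
    ∃ N : ℕ, N ≠ 0 ∧ (N : R) ∈ I := by
  obtain ⟨x, hx, hx0⟩ := Submodule.exists_mem_ne_zero_of_ne_bot hI
  obtain ⟨u, v, rfl⟩ := h.exists_eq x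
  have hne : u * u + ε * u * v + n * v * v ≠ 0 := by
    intro e
    apply hx0
    have hd := h.disc_neg
    have h4 : (2 * u + ε * v) * (2 * u + ε * v) + (4 * n - ε * ε) * (v * v) = 0 := by
      linear_combination 4 * e
    have hv : v = 0 := by
      by_contra hv
      have := mul_self_pos.mpr hv
      nlinarith [mul_self_nonneg (2 * u + ε * v)]
    subst hv
    have hu : u = 0 := by simpa using e
    simp [hu]
  have hm : ((u * u + ε * u * v + n * v * v : ℤ) : R) ∈ I := by
    have : ((u * u + ε * u * v + n * v * v : ℤ) : R) =
        (u + ε * v - v * ω) * (u + v * ω) := by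
      push_cast
      linear_combination v * v * h.sq_eq
    rw [this]
    exact I.mul_mem_left _ hx
  obtain ⟨N, hN | hN⟩ := Int.eq_nat_or_neg (u * u + ε * u * v + n * v * v)
  · exact ⟨N, by rintro rfl; simp [hN] at hne, by rw [hN] at hm; exact_mod_cast hm⟩
  · refine ⟨N, by rintro rfl; simp [hN] at hne, ?_⟩
    rw [hN] at hm
    push_cast at hm
    simpa using hm

end Basic

section Class

variable {R : Type*} [CommRing R] [IsDedekindDomain R] {ω : R} {ε n : ℤ}

theorem quadClass_eq_mk0 (h : IsImagQuadOrder ω ε n) {a : ℤ} (ha : a ≠ 0) (k : ℤ) :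
    quadClass ω a k = ClassGroup.mk0 ⟨quadIdeal ω a k,
      mem_nonZeroDivisors_of_ne_zero (h.quadIdeal_ne_bot ha k)⟩ :=
  dif_neg (h.quadIdeal_ne_bot ha k)

theorem quadClass_congr (ω : R) {a k l : ℤ} (hkl : a ∣ l - k) :
    quadClass ω a k = quadClass ω a l := by
  unfold quadClass
  simp only [quadIdeal_congr ω hkl]

theorem quadClass_one (h : IsImagQuadOrder ω ε n) (k : ℤ) : quadClass ω 1 k = 1 := by
  rw [h.quadClass_eq_mk0 one_ne_zero, ClassGroup.mk0_eq_one_iff]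
  have : quadIdeal ω 1 k = ⊤ := (Ideal.eq_top_iff_one _).mpr (Ideal.subset_span (by simp))
  rw [this]
  exact ⟨⟨1, by simp⟩⟩

theorem quadClass_flip (h : IsImagQuadOrder ω ε n) {a c k : ℤ} (ha : a ≠ 0)
    (hac : quadVal ε n k = a * c) : quadClass ω a k = quadClass ω c (-k - ε) := by
  have hpos := quadVal_pos h.disc_neg k
  have hc : c ≠ 0 := by rintro rfl; simp [hac] at hpos
  have hm := h.mul_conj k
  rw [hac] at hm
  push_cast at hm
  rw [h.quadClass_eq_mk0 ha, h.quadClass_eq_mk0 hc, ClassGroup.mk0_eq_mk0_iff]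
  refine ⟨ε - ω + k, a, ?_, h.intCast_ne_zero ha, ?_⟩
  · intro e
    rw [e, mul_zero] at hm
    exact h.intCast_ne_zero (mul_ne_zero ha hc) (by push_cast; exact hm.symm)
  · simp only [quadIdeal, Ideal.span_mul_span', Set.singleton_mul, Set.image_pair]
    have e1 : (ε - ω + k) * (ω + k) = (a : R) * c := by rw [← hm]; ring
    have e2 : (ε - ω + k) * (a : R) = -(a * (ω + ((-k - ε : ℤ) : R))) := by push_cast; ring
    rw [e1, e2, Set.pair_comm]
    simp only [Ideal.span_insert, Ideal.span_singleton_neg]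

theorem quadClass_mul (h : IsImagQuadOrder ω ε n) {a b k : ℤ} (ha : a ≠ 0) (hb : b ≠ 0)
    (hab : a * b ∣ quadVal ε n k) :
    quadClass ω a k * quadClass ω b k = quadClass ω (a * b) k := by
  have h1 := Int.gcd_eq_gcd_ab a b
  have h2 := Int.gcd_eq_gcd_ab (Int.gcd a b) (2 * k + ε)
  rw [h.gcd_eq_one hab] at h2
  rw [h.quadClass_eq_mk0 ha, h.quadClass_eq_mk0 hb, h.quadClass_eq_mk0 (mul_ne_zero ha hb),
    ← map_mul]
  congr 1
  refine Subtype.ext (h.quadIdeal_mul hab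
    (x := Int.gcdA a b * Int.gcdA (Int.gcd a b) (2 * k + ε))
    (y := Int.gcdB a b * Int.gcdA (Int.gcd a b) (2 * k + ε))
    (z := Int.gcdB (Int.gcd a b) (2 * k + ε)) ?_)
  push_cast at h2
  linear_combination -h2 - Int.gcdA (Int.gcd a b) (2 * k + ε) * h1

theorem quadClass_conj (h : IsImagQuadOrder ω ε n) {a k : ℤ} (ha : a ≠ 0)
    (hak : a ∣ quadVal ε n k) : quadClass ω a (-k - ε) = (quadClass ω a k)⁻¹ := by
  obtain ⟨c, hc⟩ := hak
  have hpos := quadVal_pos h.disc_neg k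
  have hc0 : c ≠ 0 := by rintro rfl; simp [hc] at hpos
  have e1 : quadClass ω a (-k - ε) = quadClass ω c k := by
    rw [h.quadClass_flip hc0 (k := k) (c := a) (by rw [hc]; ring)]
  have e2 : quadClass ω (a * c) k = 1 := by
    rw [h.quadClass_flip (mul_ne_zero ha hc0) (c := 1) (by rw [hc, mul_one]), h.quadClass_one]
  rw [e1, eq_inv_iff_mul_eq_one, mul_comm, h.quadClass_mul ha hc0 (by rw [hc]), e2]

theorem quadClass_pow (h : IsImagQuadOrder ω ε n) {a k : ℤ} (ha : a ≠ 0) (m : ℕ)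
    (hak : a ^ m ∣ quadVal ε n k) : quadClass ω a k ^ m = quadClass ω (a ^ m) k := by
  induction m with
  | zero => simp [h.quadClass_one]
  | succ m ih =>
    rw [pow_succ, ih ((pow_dvd_pow a m.le_succ).trans hak), pow_succ,
      h.quadClass_mul (pow_ne_zero _ ha) ha (by rwa [← pow_succ])]

/-- A nontrivial reduced ideal is not principal. -/
theorem quadClass_ne_one (h : IsImagQuadOrder ω ε n) {a c k : ℤ} (ha : 1 < a)
    (hac : quadVal ε n k = a * c) (hb : |2 * k + ε| ≤ a) (hc : a ≤ c) :
    quadClass ω a k ≠ 1 := by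
  rw [h.quadClass_eq_mk0 (by omega), Ne, ClassGroup.mk0_eq_one_iff]
  rintro ⟨⟨α, hα⟩⟩
  have hI : quadIdeal ω a k = Ideal.span {α} := hα
  have hαm : α ∈ quadIdeal ω a k := by rw [hI]; exact Ideal.mem_span_singleton_self α
  obtain ⟨w, v, hwv⟩ := h.exists_of_mem_quadIdeal ⟨c, hac⟩ hαm
  have ham : (a : R) ∈ quadIdeal ω a k := Ideal.subset_span (by simp)
  have hkm : ω + (k : R) ∈ quadIdeal ω a k := Ideal.subset_span (by simp)
  rw [hI, Ideal.mem_span_singleton] at ham hkm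
  obtain ⟨β, hβ⟩ := ham
  obtain ⟨x, y, rfl⟩ := h.exists_eq β
  obtain ⟨γ, hγ⟩ := hkm
  set u := k * v + a * w with hu
  have e : ((a : ℤ) : R) + (0 : ℤ) * ω =
      (u * x - n * v * y : ℤ) + (u * y + v * x + ε * v * y : ℤ) * ω := by
    push_cast
    rw [zero_mul, add_zero, hβ, hwv]
    linear_combination v * y * h.sq_eq
  obtain ⟨e1, e2⟩ := h.eq_of_eq e
  have hN : (u * u + ε * u * v + n * v * v) * (x * x + ε * x * y + n * y * y) = a * a := by
    have : (u * u + ε * u * v + n * v * v) * (x * x + ε * x * y + n * y * y) =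
      (u * x - n * v * y) ^ 2 + ε * (u * x - n * v * y) * (u * y + v * x + ε * v * y) +
        n * (u * y + v * x + ε * v * y) ^ 2 := by ring
    rw [this, ← e1, ← e2]; ring
  have hQ : u * u + ε * u * v + n * v * v = a * (a * w * w + (2 * k + ε) * w * v + c * v * v) := by
    unfold quadVal at hac
    rw [hu]
    linear_combination v * v * hac
  have hne : ¬ (w = 0 ∧ v = 0) := by
    rintro ⟨rfl, rfl⟩
    simp [hu] at hN
    omega
  have hge : a ≤ a * w * w + (2 * k + ε) * w * v + c * v * v := by
    have hwv1 : 1 ≤ w * w + v * v - |w * v| := by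
      have : 0 < w * w + v * v := by
        by_contra hh
        exact hne ⟨by nlinarith, by nlinarith⟩
      rcases abs_cases (w * v) with ⟨h1, _⟩ | ⟨h1, _⟩ <;> rw [h1]
      · nlinarith [sq_nonneg (w - v), sq_nonneg (w + v)]
      · nlinarith [sq_nonneg (w - v), sq_nonneg (w + v)]
    have h1 : -(a * |w * v|) ≤ (2 * k + ε) * (w * v) := by
      have := neg_abs_le ((2 * k + ε) * (w * v))
      rw [abs_mul] at this
      nlinarith [mul_le_mul_of_nonneg_right hb (abs_nonneg (w * v))]
    nlinarith [mul_le_mul_of_nonneg_right hc (mul_self_nonneg v)]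
  have hN1 : x * x + ε * x * y + n * y * y = 1 := by
    rw [hQ] at hN
    set Q := a * w * w + (2 * k + ε) * w * v + c * v * v
    set M := x * x + ε * x * y + n * y * y
    have h1 : Q * M = a := by
      apply mul_left_cancel₀ (show a ≠ 0 by omega)
      linarith
    have hM : 0 < M := by
      by_contra hM
      nlinarith
    nlinarith
  have hα2 : α = a * ((x + ε * y : ℤ) - y * ω) := by
    rw [hβ, mul_assoc]
    have := congrArg (Int.cast : ℤ → R) hN1
    push_cast at this
    have e3 : ((x : R) + y * ω) * ((x + ε * y : ℤ) - y * ω) = 1 := by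
      push_cast
      linear_combination this - y * y * h.sq_eq
    rw [e3, mul_one]
  rw [hα2, mul_assoc] at hγ
  obtain ⟨s, t, hst⟩ := h.exists_eq (((x + ε * y : ℤ) - y * ω) * γ)
  rw [hst] at hγ
  have e4 : ((k : ℤ) : R) + (1 : ℤ) * ω = (a * s : ℤ) + (a * t : ℤ) * ω := by
    push_cast
    linear_combination hγ
  have := (h.eq_of_eq e4).2
  have : a ∣ 1 := ⟨t, this⟩
  have := Int.le_of_dvd one_pos this
  omega

end Class

end IsImagQuadOrder

namespace IsImagQuadOrder

variable {R : Type*} [CommRing R] [IsDedekindDomain R] {ω : R} {ε n : ℤ}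

/-- The balanced representative of `k` modulo `a`. -/
theorem abs_balance {a k ε : ℤ} (ha : 0 < a) :
    |2 * (k - a * ((2 * k + ε + a) / (2 * a))) + ε| ≤ a := by
  have h1 := Int.mul_ediv_add_emod (2 * k + ε + a) (2 * a)
  have h2 := Int.emod_nonneg (2 * k + ε + a) (show 2 * a ≠ 0 by omega)
  have h3 := Int.emod_lt_of_pos (2 * k + ε + a) (show 0 < 2 * a by omega)
  rw [abs_le]
  constructor <;> linarith

theorem quadClass_mem (h : IsImagQuadOrder ω ε n) (S : Subgroup (ClassGroup R))
    (hS : ∀ p : ℕ, p.Prime → 3 * (p : ℤ) * p ≤ 4 * n - ε * ε →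
      ∀ k : ℤ, (p : ℤ) ∣ quadVal ε n k → quadClass ω p k ∈ S)
    (a : ℕ) (ha : 0 < a) (k : ℤ) (hak : (a : ℤ) ∣ quadVal ε n k) : quadClass ω a k ∈ S := by
  induction a using Nat.strong_induction_on generalizing k with
  | _ a ih =>
    rcases Nat.lt_or_ge 1 a with ha1 | ha1
    swap
    · obtain rfl : a = 1 := by omega
      simp [h.quadClass_one, one_mem]
    by_cases hp : a.Prime
    · by_cases hle : 3 * (a : ℤ) * a ≤ 4 * n - ε * ε
      · exact hS a hp hle k hak
      · have haZ : (0 : ℤ) < a := by exact_mod_cast ha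
        have hbal := abs_balance (k := k) (ε := ε) haZ
        set l := k - a * ((2 * k + ε + a) / (2 * a)) with hl
        have hdv : (a : ℤ) ∣ l - k := ⟨-((2 * k + ε + a) / (2 * a)), by rw [hl]; ring⟩
        obtain ⟨c, hc⟩ := dvd_quadVal_of_dvd_sub hak hdv
        rw [quadClass_congr ω hdv, h.quadClass_flip haZ.ne' hc]
        have hpos := quadVal_pos h.disc_neg l
        have hc0 : 0 < c := by rw [hc] at hpos; exact pos_of_mul_pos_right hpos haZ.le
        have hca : c < a := by
          have h4 : 4 * (a * c) = (2 * l + ε) * (2 * l + ε) + (4 * n - ε * ε) := by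
            rw [← hc]; unfold quadVal; ring
          have h5 : (2 * l + ε) * (2 * l + ε) ≤ a * a := by
            rw [← abs_mul_abs_self]
            exact mul_self_le_mul_self (abs_nonneg _) hbal
          nlinarith
        lift c to ℕ using hc0.le
        refine ih c (by exact_mod_cast hca) (by exact_mod_cast hc0) _ ?_
        rw [quadVal_conj, hc]
        exact dvd_mul_left _ _
    · obtain ⟨b, hb, hb1, hb2⟩ := Nat.exists_dvd_of_not_prime ha1 hp
      obtain ⟨c, rfl⟩ := hb
      have hb0 : 0 < b := Nat.pos_of_mul_pos_right ha
      have hc0 : 0 < c := Nat.pos_of_mul_pos_left ha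
      have hbb : b < b * c := lt_of_le_of_ne (Nat.le_mul_of_pos_right b hc0) hb2
      have hcc : c < b * c := by nlinarith [show 2 ≤ b by omega]
      push_cast at hak ⊢
      rw [← h.quadClass_mul (by exact_mod_cast hb0.ne') (by exact_mod_cast hc0.ne') hak]
      exact mul_mem (ih b hbb hb0 k ((dvd_mul_right _ _).trans hak))
        (ih c hcc hc0 k ((dvd_mul_left _ _).trans hak))

theorem mk0_prime_mem (h : IsImagQuadOrder ω ε n) (S : Subgroup (ClassGroup R))
    (hS : ∀ p : ℕ, p.Prime → ∀ k : ℤ, (p : ℤ) ∣ quadVal ε n k → quadClass ω p k ∈ S)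
    {P : Ideal R} (hP : P.IsPrime) (hP0 : P ≠ ⊥) :
    ClassGroup.mk0 ⟨P, mem_nonZeroDivisors_of_ne_zero hP0⟩ ∈ S := by
  obtain ⟨p, hp, hpP⟩ : ∃ p : ℕ, p.Prime ∧ (p : R) ∈ P := by
    obtain ⟨N, hN0, hN⟩ := h.exists_nat_mem hP0
    induction N using Nat.recOnMul with
    | zero => exact absurd rfl hN0
    | one => exact absurd ((Ideal.eq_top_iff_one P).mpr (by simpa using hN)) hP.ne_top
    | prime q hq => exact ⟨q, hq, hN⟩
    | mul a b iha ihb =>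
      rw [Nat.cast_mul] at hN
      rcases hP.mem_or_mem hN with h' | h'
      · exact iha (left_ne_zero_of_mul hN0) h'
      · exact ihb (right_ne_zero_of_mul hN0) h'
  have hdvd : ∀ z : ℤ, (z : R) ∈ P → (p : ℤ) ∣ z := by
    intro z hz
    by_contra hnd
    have hcop : IsCoprime (p : ℤ) z :=
      (Prime.coprime_iff_not_dvd (Nat.prime_iff_prime_int.mp hp)).mpr hnd
    obtain ⟨s, t, hst⟩ := hcop
    refine hP.ne_top ((Ideal.eq_top_iff_one P).mpr ?_)
    have := congrArg (Int.cast : ℤ → R) hst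
    push_cast at this
    rw [← this]
    exact add_mem (P.mul_mem_left _ hpP) (P.mul_mem_left _ hz)
  by_cases hk : ∃ k : ℤ, ω + (k : R) ∈ P
  · obtain ⟨k, hk⟩ := hk
    have hpk : (p : ℤ) ∣ quadVal ε n k := by
      apply hdvd
      rw [← h.mul_conj]
      exact P.mul_mem_right _ hk
    have hPe : P = quadIdeal ω p k := by
      apply le_antisymm
      · intro x hx
        obtain ⟨u, v, rfl⟩ := h.exists_eq x
        have : ((u - k * v : ℤ) : R) ∈ P := by
          have : ((u - k * v : ℤ) : R) = (u + v * ω) - v * (ω + k) := by push_cast; ring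
          rw [this]
          exact sub_mem hx (P.mul_mem_left _ hk)
        obtain ⟨w, hw⟩ := hdvd _ this
        have hu : (u : R) = k * v + p * w := by
          have : u = k * v + p * w := by linarith
          rw [this]; push_cast; ring
        rw [quadIdeal, Ideal.mem_span_pair]
        exact ⟨w, v, by rw [hu]; push_cast; ring⟩
      · rw [quadIdeal, Ideal.span_le]
        rintro x (rfl | rfl)
        · simpa using hpP
        · exact hk
    have := hS p hp k hpk
    rw [h.quadClass_eq_mk0 (by exact_mod_cast hp.ne_zero)] at this
    simpa only [← hPe] using this
  · have hPe : P = Ideal.span {(p : R)} := by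
      apply le_antisymm
      · intro x hx
        obtain ⟨u, v, rfl⟩ := h.exists_eq x
        have hv : (p : ℤ) ∣ v := by
          by_contra hnd
          have hcop : IsCoprime (p : ℤ) v :=
            (Prime.coprime_iff_not_dvd (Nat.prime_iff_prime_int.mp hp)).mpr hnd
          obtain ⟨s, t, hst⟩ := hcop
          refine hk ⟨t * u, ?_⟩
          have e := congrArg (Int.cast : ℤ → R) hst
          push_cast at e
          have : ω + ((t * u : ℤ) : R) = t * (u + v * ω) + s * ω * p := by
            push_cast
            linear_combination (-ω) * e
          rw [this]
          exact add_mem (P.mul_mem_left _ hx) (P.mul_mem_left _ hpP)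
        obtain ⟨v, rfl⟩ := hv
        have hu : (p : ℤ) ∣ u := by
          apply hdvd
          have : (u : R) = (u + ((p * v : ℤ) : R) * ω) - v * ω * p := by push_cast; ring
          rw [this]
          exact sub_mem hx (P.mul_mem_left _ hpP)
        obtain ⟨u, rfl⟩ := hu
        rw [Ideal.mem_span_singleton]
        exact ⟨u + v * ω, by push_cast; ring⟩
      · rwa [Ideal.span_singleton_le_iff_mem]
    have : ClassGroup.mk0 ⟨P, mem_nonZeroDivisors_of_ne_zero hP0⟩ = 1 := by
      rw [ClassGroup.mk0_eq_one_iff]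
      exact ⟨⟨p, hPe⟩⟩
    rw [this]
    exact one_mem S

/-- The ideal class group is generated by the classes of the primes `(p, ω + k)` with
`3 * p ^ 2 ≤ |disc|`. -/
theorem mem_of_forall_prime (h : IsImagQuadOrder ω ε n) (S : Subgroup (ClassGroup R))
    (hS : ∀ p : ℕ, p.Prime → 3 * (p : ℤ) * p ≤ 4 * n - ε * ε →
      ∀ k : ℤ, (p : ℤ) ∣ quadVal ε n k → quadClass ω p k ∈ S) (g : ClassGroup R) : g ∈ S := by
  obtain ⟨⟨I, hI⟩, rfl⟩ := ClassGroup.mk0_surjective g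
  induction I using UniqueFactorizationMonoid.induction_on_prime with
  | h₁ => exact absurd rfl (nonZeroDivisors.ne_zero hI)
  | h₂ I hu =>
    have : ClassGroup.mk0 ⟨I, hI⟩ = 1 := by
      rw [ClassGroup.mk0_eq_one_iff]
      have : I = ⊤ := Ideal.isUnit_iff.mp hu
      subst this
      exact ⟨⟨1, by simp⟩⟩
    rw [this]
    exact one_mem S
  | h₃ I P hI0 hP ih =>
    have hP0 := hP.ne_zero
    have e : (⟨P * I, hI⟩ : nonZeroDivisors (Ideal R)) =
        ⟨P, mem_nonZeroDivisors_of_ne_zero hP0⟩ * ⟨I, mem_nonZeroDivisors_of_ne_zero hI0⟩ := rfl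
    rw [e, map_mul]
    exact mul_mem (h.mk0_prime_mem S (fun p hp k hk => h.quadClass_mem S hS p hp.pos k hk)
      (Ideal.isPrime_of_prime hP) hP0) (ih _)

end IsImagQuadOrder

/-- `f z`, with `z` brought to constructor form first; this speeds up kernel evaluation. -/
def Int.force {α : Type*} (z : ℤ) (f : ℤ → α) : α :=
  match z with
  | .ofNat 0 => f 0
  | .ofNat (m + 1) => f (.ofNat (m + 1))
  | .negSucc 0 => f (-1)
  | .negSucc (m + 1) => f (.negSucc (m + 1))

theorem Int.force_eq {α : Type*} (z : ℤ) (f : ℤ → α) : z.force f = f z := by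
  rcases z with (_ | m) | (_ | m) <;> rfl

/-- Gauss reduction of the ideal `(a, ω + k)` within a bounded number of steps. -/
def quadReduce (ε n : ℤ) : ℕ → ℤ → ℤ → ℤ × ℤ
  | 0, a, k => (a, k)
  | s + 1, a, k =>
    (k - a * ((2 * k + ε + a) / (2 * a))).force fun l =>
      (quadVal ε n l / a).force fun c =>
        if c < a then quadReduce ε n s c (-l - ε) else (a, l)

/-- A test for primality of `p < 841`. -/
def isSmallPrime (p : ℕ) : Bool :=
  Nat.blt 1 p && Nat.blt p 841 &&
    [2, 3, 5, 7, 11, 13, 17, 19, 23].all fun q => !(p % q == 0) || p == q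

theorem prime_of_isSmallPrime {p : ℕ} (h : isSmallPrime p = true) : p.Prime := by
  simp only [isSmallPrime, Bool.and_eq_true, Nat.blt_eq, List.all_cons, List.all_nil,
    Bool.or_eq_true, Bool.not_eq_true', beq_eq_false_iff_ne, beq_iff_eq] at h
  obtain ⟨⟨h1, h2⟩, h3⟩ := h
  by_contra hp
  have hq := Nat.minFac_prime (show p ≠ 1 by omega)
  have hsq := Nat.minFac_sq_le_self (by omega) hp
  have hd := Nat.mod_eq_zero_of_dvd (Nat.minFac_dvd p)
  have hne : p ≠ p.minFac := fun e => hp (e ▸ hq)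
  have hlt : p.minFac < 29 := by nlinarith
  generalize p.minFac = q at hq hsq hd hne hlt
  interval_cases q <;> first | omega | (revert hq; norm_num)

theorem isSmallPrime_of_prime {p : ℕ} (h : p.Prime) (hp : p < 841) : isSmallPrime p = true := by
  simp only [isSmallPrime, Bool.and_eq_true, Nat.blt_eq, List.all_eq_true,
    Bool.or_eq_true, Bool.not_eq_true', beq_eq_false_iff_ne, beq_iff_eq]
  refine ⟨⟨h.one_lt, hp⟩, fun q hq => or_iff_not_imp_left.mpr fun hd => ?_⟩
  rw [not_not] at hd
  have hq1 : q ≠ 1 := by rintro rfl; simp at hq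
  exact ((h.eq_one_or_self_of_dvd q (Nat.dvd_of_mod_eq_zero hd)).resolve_left hq1).symm

/-- A test which shows that `X² + εX + n` has no root modulo the prime `p`. -/
def isInert (ε n : ℤ) (p : ℕ) : Bool :=
  if p = 2 then !(quadVal ε n 0 % 2 == 0) && !(quadVal ε n 1 % 2 == 0)
  else
    !((ε * ε - 4 * n) % p == 0) && !(((ε * ε - 4 * n) % p).toNat ^ ((p - 1) / 2) % p == 1)

theorem not_dvd_of_isInert {ε n : ℤ} {p : ℕ} (hp : p.Prime) (h : isInert ε n p = true) (k : ℤ) :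
    ¬ (p : ℤ) ∣ quadVal ε n k := by
  intro hk
  unfold isInert at h
  split_ifs at h with h2
  · subst h2
    simp only [Bool.and_eq_true, Bool.not_eq_true', beq_eq_false_iff_ne] at h
    rcases Int.even_or_odd' k with ⟨t, rfl | rfl⟩
    · exact h.1 (Int.emod_eq_zero_of_dvd (dvd_quadVal_of_dvd_sub hk ⟨-t, by ring⟩))
    · exact h.2 (Int.emod_eq_zero_of_dvd (dvd_quadVal_of_dvd_sub hk ⟨-t, by ring⟩))
  · simp only [Bool.and_eq_true, Bool.not_eq_true', beq_eq_false_iff_ne] at h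
    obtain ⟨h0, h1⟩ := h
    have : Fact p.Prime := ⟨hp⟩
    have hodd := hp.eq_two_or_odd'.resolve_left h2
    have hsq : (((ε * ε - 4 * n : ℤ)) : ZMod p) = ((2 * k + ε : ℤ) : ZMod p) ^ 2 := by
      have := (ZMod.intCast_zmod_eq_zero_iff_dvd (quadVal ε n k) p).mpr hk
      unfold quadVal at this
      push_cast at this ⊢
      linear_combination (-4) * this
    have hne : ((ε * ε - 4 * n : ℤ) : ZMod p) ≠ 0 := by
      rw [Ne, ZMod.intCast_zmod_eq_zero_iff_dvd]
      exact fun hd => h0 (Int.emod_eq_zero_of_dvd hd)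
    have hk0 : ((2 * k + ε : ℤ) : ZMod p) ≠ 0 := by
      intro e
      exact hne (by rw [hsq, e]; simp)
    have hpow : ((ε * ε - 4 * n : ℤ) : ZMod p) ^ ((p - 1) / 2) = 1 := by
      rw [hsq, ← pow_mul, Nat.mul_div_cancel' (show 2 ∣ p - 1 by obtain ⟨t, rfl⟩ := hodd; simp),
        ZMod.pow_card_sub_one_eq_one hk0]
    apply h1
    have hr : ((((ε * ε - 4 * n) % p).toNat : ℕ) : ZMod p) = ((ε * ε - 4 * n : ℤ) : ZMod p) := by
      rw [← Int.cast_natCast (R := ZMod p),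
        Int.toNat_of_nonneg (Int.emod_nonneg _ (by exact_mod_cast hp.ne_zero)),
        ZMod.intCast_mod]
    rw [← hr] at hpow
    have := (ZMod.natCast_eq_natCast_iff' (((ε * ε - 4 * n) % p).toNat ^ ((p - 1) / 2)) 1 p).mp
      (by push_cast; exact_mod_cast hpow)
    rwa [Nat.mod_eq_of_lt hp.one_lt] at this

/-- Checks that the prime ideals of norm at most `B` lie in the subgroup generated by those above
the primes in a given list, using numbers `k` with `N(ω + k) = p * qs.prod`. -/
def checkPrimes (ε n : ℤ) (B : ℕ) : List ℕ → List (ℕ × ℤ × List ℕ) → Bool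
  | ps, [] => (List.range (B + 1)).all fun p =>
      !isSmallPrime p || (isInert ε n p || ps.contains p)
  | ps, (p, k, qs) :: t =>
      isSmallPrime p && qs.all (fun q => ps.contains q) && quadVal ε n k == (p * qs.prod : ℕ) &&
        checkPrimes ε n B (p :: ps) t

namespace IsImagQuadOrder

variable {R : Type*} [CommRing R] [IsDedekindDomain R] {ω : R} {ε n : ℤ}

theorem quadClass_quadReduce (h : IsImagQuadOrder ω ε n) (s : ℕ) {a k : ℤ} (ha : 0 < a)
    (hak : a ∣ quadVal ε n k) :
    quadClass ω (quadReduce ε n s a k).1 (quadReduce ε n s a k).2 = quadClass ω a k := by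
  induction s generalizing a k with
  | zero => rfl
  | succ s ih =>
    rw [quadReduce]
    simp only [Int.force_eq]
    set l := k - a * ((2 * k + ε + a) / (2 * a)) with hl
    have hdv : a ∣ l - k := ⟨-((2 * k + ε + a) / (2 * a)), by rw [hl]; ring⟩
    have hal := dvd_quadVal_of_dvd_sub hak hdv
    have hc : quadVal ε n l = a * (quadVal ε n l / a) := (Int.mul_ediv_cancel' hal).symm
    set c := quadVal ε n l / a
    have hpos := quadVal_pos h.disc_neg l
    split_ifs with hlt
    · rw [ih (by rw [hc] at hpos; exact pos_of_mul_pos_right hpos ha.le)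
        (by rw [quadVal_conj, hc]; exact dvd_mul_left _ _), quadClass_congr ω hdv,
        h.quadClass_flip ha.ne' hc]
    · rw [quadClass_congr ω hdv]

theorem dvd_or_dvd_of_dvd_quadVal {p k l : ℤ} (hp : Prime p) (hk : p ∣ quadVal ε n k)
    (hl : p ∣ quadVal ε n l) : p ∣ l - k ∨ p ∣ l - (-k - ε) := by
  apply hp.dvd_or_dvd
  have : (l - k) * (l - (-k - ε)) = quadVal ε n l - quadVal ε n k := by unfold quadVal; ring
  rw [this]
  exact dvd_sub hl hk

theorem quadClass_prod_mem (h : IsImagQuadOrder ω ε n) (S : Subgroup (ClassGroup R)) {k : ℤ}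
    (qs : List ℕ) (hqs : ∀ q ∈ qs, q ≠ 0 ∧ ((q : ℤ) ∣ quadVal ε n k → quadClass ω q k ∈ S))
    (hd : (qs.prod : ℤ) ∣ quadVal ε n k) : quadClass ω qs.prod k ∈ S := by
  induction qs with
  | nil => simp [h.quadClass_one, one_mem]
  | cons q qs ih =>
    rw [List.prod_cons] at hd ⊢
    rw [Nat.cast_mul] at hd ⊢
    have hq := hqs q (by simp)
    have h0 : qs.prod ≠ 0 := by
      rw [Ne, List.prod_eq_zero_iff]
      exact fun hm => (hqs 0 (List.mem_cons_of_mem _ hm)).1 rfl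
    rw [← h.quadClass_mul (by exact_mod_cast hq.1) (by exact_mod_cast h0) hd]
    exact mul_mem (hq.2 ((dvd_mul_right _ _).trans hd))
      (ih (fun q hq => hqs q (List.mem_cons_of_mem _ hq)) ((dvd_mul_left _ _).trans hd))

theorem mem_of_checkPrimes (h : IsImagQuadOrder ω ε n) (S : Subgroup (ClassGroup R)) {B : ℕ}
    (hB : B < 841) (certs : List (ℕ × ℤ × List ℕ)) (ps : List ℕ)
    (hps : ∀ p ∈ ps, p ≠ 0 ∧ ∀ k : ℤ, (p : ℤ) ∣ quadVal ε n k → quadClass ω p k ∈ S)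
    (hcheck : checkPrimes ε n B ps certs = true) {p : ℕ} (hp : p.Prime) (hpB : p ≤ B) {k : ℤ}
    (hpk : (p : ℤ) ∣ quadVal ε n k) : quadClass ω p k ∈ S := by
  induction certs generalizing ps with
  | nil =>
    rw [checkPrimes, List.all_eq_true] at hcheck
    have := hcheck p (List.mem_range.mpr (by omega))
    rw [isSmallPrime_of_prime hp (by omega), Bool.not_true, Bool.false_or, Bool.or_eq_true,
      List.contains_iff_mem] at this
    rcases this with hi | hm
    · exact absurd hpk (not_dvd_of_isInert hp hi k)
    · exact (hps p hm).2 k hpk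
  | cons c t ih =>
    obtain ⟨q, l, qs⟩ := c
    simp only [checkPrimes, Bool.and_eq_true, beq_iff_eq, List.all_eq_true,
      List.contains_iff_mem] at hcheck
    obtain ⟨⟨⟨hq, hqs⟩, hl⟩, ht⟩ := hcheck
    have hq := prime_of_isSmallPrime hq
    refine ih (q :: ps) ?_ ht
    rintro r hr
    rcases List.mem_cons.mp hr with rfl | hr
    swap
    · exact hps r hr
    refine ⟨hq.ne_zero, fun k hk => ?_⟩
    rw [Nat.cast_mul] at hl
    have hr0 : (r : ℤ) ≠ 0 := by exact_mod_cast hq.ne_zero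
    have key : ∀ l : ℤ, quadVal ε n l = r * qs.prod → quadClass ω r l ∈ S := by
      intro l hl
      rw [h.quadClass_flip hr0 hl]
      refine h.quadClass_prod_mem S qs (fun q hq => ⟨(hps q (hqs q hq)).1, (hps q (hqs q hq)).2 _⟩)
        ?_
      rw [quadVal_conj, hl]
      exact dvd_mul_left _ _
    rcases dvd_or_dvd_of_dvd_quadVal (Nat.prime_iff_prime_int.mp hq) (k := l)
      (by rw [hl]; exact dvd_mul_right _ _) hk with hd | hd
    · rw [← quadClass_congr ω hd]
      exact key l hl
    · rw [← quadClass_congr ω hd]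
      exact key _ (by rw [quadVal_conj, hl])

end IsImagQuadOrder

/-- In a finite commutative group whose `m`-th powers, `m` prime to `3`, lie in the subgroup
generated by two independent elements of order `3`, the Sylow `3`-subgroup is `C₃ × C₃`. -/
theorem nonempty_sylow_three_mulEquiv {G : Type*} [CommGroup G] [Finite G] {x y : G}
    (hx : x ^ 3 = 1) (hy : y ^ 3 = 1) (hx1 : x ≠ 1) (hy1 : y ≠ 1) (hxy : x * y ≠ 1)
    (hxy' : x * y⁻¹ ≠ 1) {m : ℕ} (hm : Nat.Coprime m 3)
    (h : ∀ g : G, g ^ m ∈ Subgroup.closure {x, y}) (P : Sylow 3 G) :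
    Nonempty (P ≃* Multiplicative (ZMod 3 × ZMod 3)) := by
  have : Fact (Nat.Prime 3) := ⟨Nat.prime_three⟩
  have h0 : ∀ z : G, z ^ 3 = 1 →
      zmultiplesHom (Additive G) (Additive.ofMul z) ((3 : ℕ) : ℤ) = 0 := by
    intro z hz
    change Additive.ofMul (z ^ ((3 : ℕ) : ℤ)) = 0
    rw [zpow_natCast, hz]
    rfl
  let f : ∀ z : G, z ^ 3 = 1 → (ZMod 3 →+ Additive G) := fun z hz =>
    ZMod.lift 3 ⟨zmultiplesHom (Additive G) (Additive.ofMul z), h0 z hz⟩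
  have hf : ∀ (z : G) (hz : z ^ 3 = 1) (i : ℕ), f z hz (i : ZMod 3) = Additive.ofMul (z ^ i) := by
    intro z hz i
    have := ZMod.lift_coe 3 ⟨zmultiplesHom (Additive G) (Additive.ofMul z), h0 z hz⟩ (i : ℤ)
    simpa [f, ← ofMul_pow] using this
  let F : Multiplicative (ZMod 3 × ZMod 3) →* G :=
    AddMonoidHom.toMultiplicativeLeft ((f x hx).coprod (f y hy))
  have hF : ∀ i j : ℕ, F (Multiplicative.ofAdd ((i : ZMod 3), (j : ZMod 3))) = x ^ i * y ^ j := by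
    intro i j
    change Additive.toMul (f x hx i + f y hy j) = _
    rw [hf x hx, hf y hy]
    rfl
  have hlt : ∀ u : ZMod 3, ∃ i < 3, ((i : ℕ) : ZMod 3) = u := fun u =>
    ⟨u.val, u.val_lt, ZMod.natCast_zmod_val u⟩
  have hinj : Function.Injective F := by
    rw [injective_iff_map_eq_one]
    intro u hu
    obtain ⟨⟨a, b⟩, rfl⟩ := Multiplicative.ofAdd.surjective u
    obtain ⟨i, hi, rfl⟩ := hlt a
    obtain ⟨j, hj, rfl⟩ := hlt b
    rw [hF] at hu
    have hx2 : x ^ 2 = x⁻¹ := eq_inv_of_mul_eq_one_left (by rw [← pow_succ, hx])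
    have hy2 : y ^ 2 = y⁻¹ := eq_inv_of_mul_eq_one_left (by rw [← pow_succ, hy])
    interval_cases i <;> interval_cases j <;> simp only [pow_zero, pow_one, hx2, hy2, one_mul,
      mul_one, inv_eq_one] at hu
    · rfl
    · exact absurd hu hy1
    · exact absurd hu hy1
    · exact absurd hu hx1
    · exact absurd hu hxy
    · exact absurd hu hxy'
    · exact absurd hu hx1
    · exact absurd (by rw [inv_mul_eq_one.mp hu, mul_inv_cancel]) hxy'
    · exact absurd (by rw [← inv_eq_one, mul_inv, hu]) hxy
  have hle : Subgroup.closure {x, y} ≤ F.range := by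
    rw [Subgroup.closure_le]
    rintro z (rfl | rfl)
    · exact ⟨_, by simpa using hF 1 0⟩
    · exact ⟨_, by simpa using hF 0 1⟩
  have hcard : Nat.card F.range = 3 ^ 2 := by
    rw [← Nat.card_congr (MonoidHom.ofInjective hinj).toEquiv]
    simp [Nat.card_eq_fintype_card]
  have hp : IsPGroup 3 F.range := IsPGroup.of_card hcard
  obtain ⟨Q, hQ⟩ := hp.exists_le_sylow
  have hsub : Subsingleton (Sylow 3 G) := Sylow.unique_of_normal P inferInstance |>.instSubsingleton
  have hPF : (P : Subgroup G) = F.range := by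
    apply le_antisymm
    · intro g hg
      obtain ⟨k, hk⟩ := P.isPGroup' ⟨g, hg⟩
      have hk' : g ^ 3 ^ k = 1 := congrArg Subtype.val hk
      have hc : (orderOf g).Coprime m :=
        Nat.Coprime.coprime_dvd_left (orderOf_dvd_of_pow_eq_one hk') (hm.symm.pow_left k)
      obtain ⟨t, ht⟩ := exists_pow_eq_self_of_coprime hc.symm
      rw [← ht]
      exact pow_mem (hle (h g)) t
    · rwa [Subsingleton.elim P Q]
  exact ⟨(MulEquiv.subgroupCongr hPF).trans (MonoidHom.ofInjective hinj).symm⟩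

/-- A test for `(a, ω + k)` to be a nontrivial reduced ideal. -/
def isReduced (ε n : ℤ) (r : ℤ × ℤ) : Bool :=
  decide (1 < r.1) && decide (-r.1 ≤ 2 * r.2 + ε) && decide (2 * r.2 + ε ≤ r.1) &&
    quadVal ε n r.2 % r.1 == 0 && decide (r.1 * r.1 ≤ quadVal ε n r.2)

/-- Checks that `(a, ω + k)` has class of order dividing `3`. -/
def isCubeTrivial (ε n a k : ℤ) : Bool :=
  decide (0 < a) && quadVal ε n k % (a * a * a) == 0 && (quadReduce ε n 1000 (a * a * a) k).1 == 1

/-- Checks that the product of `(a, ω + k)` and `(b, ω + l)` is `(a * b, ω + j)`, and that its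
class is nontrivial. -/
def isProduct (ε n a k b l j : ℤ) : Bool :=
  quadVal ε n j % (a * b) == 0 && (j - k) % a == 0 && (j - l) % b == 0 &&
    isReduced ε n (quadReduce ε n 1000 (a * b) j)

/-- Checks that the `m`-th power of `(q, ω + k)` is trivial or equivalent to a member of a list or
to the conjugate of one. -/
def isPowMem (ε n : ℤ) (m : ℕ) (rs : List (ℤ × ℤ)) (q : ℕ) (k : ℤ) : Bool :=
  isSmallPrime q && quadVal ε n k % (q ^ m : ℕ) == 0 &&
    ((quadReduce ε n 1000 (q ^ m : ℕ) k).1 == 1 ||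
      rs.any fun r => quadReduce ε n 1000 (q ^ m : ℕ) k == r ||
        quadReduce ε n 1000 (q ^ m : ℕ) k == (r.1, -r.2 - ε))

/-- A certificate that the `3`-class group of an imaginary quadratic field is `C₃ × C₃`. -/
structure ThreeClassCert where
  /-- The primes up to `B` generate the class group. -/
  B : ℕ
  /-- An exponent prime to `3` which kills the class group up to `3`-torsion. -/
  m : ℕ
  /-- The norm of the first generator `(a, ω + k)` of the `3`-class group. -/
  a : ℤ
  /-- The first generator is `(a, ω + k)`. -/
  k : ℤ
  /-- The norm of the second generator `(b, ω + l)` of the `3`-class group. -/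
  b : ℤ
  /-- The second generator is `(b, ω + l)`. -/
  l : ℤ
  /-- The product of the generators is `(a * b, ω + i)`. -/
  i : ℤ
  /-- The quotient of the generators is `(a * b, ω + j)` up to principal ideals. -/
  j : ℤ
  /-- Primes whose classes generate the class group, with roots modulo their `m`-th powers. -/
  base : List (ℕ × ℤ)
  /-- Relations expressing the other primes. -/
  rels : List (ℕ × ℤ × List ℕ)

/-- The validity test for a certificate. -/
def ThreeClassCert.check (c : ThreeClassCert) (ε n : ℤ) : Bool :=
  Nat.blt c.B 841 && decide (4 * n - ε * ε < 3 * (c.B + 1 : ℕ) * (c.B + 1 : ℕ)) &&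
  !(c.m % 3 == 0) &&
  isCubeTrivial ε n c.a c.k && isCubeTrivial ε n c.b c.l &&
  isReduced ε n (quadReduce ε n 1000 c.a c.k) && isReduced ε n (quadReduce ε n 1000 c.b c.l) &&
  isProduct ε n c.a c.k c.b c.l c.i && isProduct ε n c.a c.k c.b (-c.l - ε) c.j &&
  c.base.all (fun p => isPowMem ε n c.m
    [quadReduce ε n 1000 c.a c.k, quadReduce ε n 1000 c.b c.l,
      quadReduce ε n 1000 (c.a * c.b) c.i, quadReduce ε n 1000 (c.a * c.b) c.j] p.1 p.2) &&
  checkPrimes ε n c.B (c.base.map Prod.fst) c.rels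

namespace IsImagQuadOrder

variable {R : Type*} [CommRing R] [IsDedekindDomain R] {ω : R} {ε n : ℤ}

theorem ne_one_of_isReduced (h : IsImagQuadOrder ω ε n) {r : ℤ × ℤ}
    (hr : isReduced ε n r = true) : quadClass ω r.1 r.2 ≠ 1 := by
  simp only [isReduced, Bool.and_eq_true, decide_eq_true_eq, beq_iff_eq] at hr
  obtain ⟨⟨⟨⟨h1, h2⟩, h3⟩, h4⟩, h5⟩ := hr
  obtain ⟨c, hc⟩ := Int.dvd_of_emod_eq_zero h4
  refine h.quadClass_ne_one h1 hc (abs_le.mpr ⟨h2, h3⟩) ?_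
  rw [hc] at h5
  exact le_of_mul_le_mul_left h5 (by omega)

theorem quadClass_conj_of_isReduced (h : IsImagQuadOrder ω ε n) {r : ℤ × ℤ}
    (hr : isReduced ε n r = true) : quadClass ω r.1 (-r.2 - ε) = (quadClass ω r.1 r.2)⁻¹ := by
  simp only [isReduced, Bool.and_eq_true, decide_eq_true_eq, beq_iff_eq] at hr
  obtain ⟨⟨⟨⟨h1, h2⟩, h3⟩, h4⟩, h5⟩ := hr
  exact h.quadClass_conj (by omega) (Int.dvd_of_emod_eq_zero h4)

theorem eq_one_of_quadReduce (h : IsImagQuadOrder ω ε n) {s : ℕ} {a k : ℤ} (ha : 0 < a)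
    (hak : a ∣ quadVal ε n k) (h1 : (quadReduce ε n s a k).1 = 1) : quadClass ω a k = 1 := by
  rw [← h.quadClass_quadReduce s ha hak, h1, h.quadClass_one]

theorem of_isCubeTrivial (h : IsImagQuadOrder ω ε n) {a k : ℤ}
    (hr : isCubeTrivial ε n a k = true) :
    0 < a ∧ a ∣ quadVal ε n k ∧ quadClass ω a k ^ 3 = 1 := by
  simp only [isCubeTrivial, Bool.and_eq_true, decide_eq_true_eq, beq_iff_eq] at hr
  obtain ⟨⟨h1, h2⟩, h3⟩ := hr
  have hd := Int.dvd_of_emod_eq_zero h2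
  refine ⟨h1, (Dvd.intro_left (a * a) rfl).trans hd, ?_⟩
  have e : a ^ 3 = a * a * a := by ring
  rw [h.quadClass_pow h1.ne' 3 (by rwa [e]), e]
  exact h.eq_one_of_quadReduce (by positivity) hd h3

theorem of_isProduct (h : IsImagQuadOrder ω ε n) {a k b l j : ℤ} (ha : 0 < a) (hb : 0 < b)
    (hr : isProduct ε n a k b l j = true) :
    quadClass ω (quadReduce ε n 1000 (a * b) j).1 (quadReduce ε n 1000 (a * b) j).2 =
      quadClass ω a k * quadClass ω b l ∧ isReduced ε n (quadReduce ε n 1000 (a * b) j) = true := by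
  simp only [isProduct, Bool.and_eq_true, beq_iff_eq] at hr
  obtain ⟨⟨⟨h1, h2⟩, h3⟩, h4⟩ := hr
  have hd := Int.dvd_of_emod_eq_zero h1
  rw [h.quadClass_quadReduce _ (mul_pos ha hb) hd, ← h.quadClass_mul ha.ne' hb.ne' hd,
    quadClass_congr ω (Int.dvd_of_emod_eq_zero h2), quadClass_congr ω (Int.dvd_of_emod_eq_zero h3)]
  exact ⟨rfl, h4⟩

theorem of_isPowMem (h : IsImagQuadOrder ω ε n) (E : Subgroup (ClassGroup R)) {m : ℕ}
    {rs : List (ℤ × ℤ)} (hrs : ∀ r ∈ rs, isReduced ε n r = true ∧ quadClass ω r.1 r.2 ∈ E)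
    {q : ℕ} {k : ℤ} (hm : m ≠ 0) (hq : isPowMem ε n m rs q k = true) {l : ℤ}
    (hl : (q : ℤ) ∣ quadVal ε n l) : quadClass ω q l ^ m ∈ E := by
  simp only [isPowMem, Bool.and_eq_true, beq_iff_eq, Bool.or_eq_true, List.any_eq_true] at hq
  obtain ⟨⟨h1, h2⟩, h3⟩ := hq
  have hp := prime_of_isSmallPrime h1
  have hd := Int.dvd_of_emod_eq_zero h2
  have hq0 : (q : ℤ) ≠ 0 := by exact_mod_cast hp.ne_zero
  have hpos : (0 : ℤ) < (q ^ m : ℕ) := by exact_mod_cast pow_pos hp.pos m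
  have hqk : (q : ℤ) ∣ quadVal ε n k :=
    (by exact_mod_cast dvd_pow_self q hm : (q : ℤ) ∣ (q ^ m : ℕ)).trans hd
  have key : quadClass ω q k ^ m ∈ E := by
    rw [h.quadClass_pow hq0 m (by exact_mod_cast hd), ← Nat.cast_pow,
      ← h.quadClass_quadReduce 1000 hpos hd]
    rcases h3 with h3 | ⟨r, hr, h3 | h3⟩
    · rw [h3, h.quadClass_one]
      exact one_mem E
    · rw [h3]
      exact (hrs r hr).2
    · rw [h3, h.quadClass_conj_of_isReduced (hrs r hr).1]
      exact inv_mem (hrs r hr).2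
  rcases dvd_or_dvd_of_dvd_quadVal (Nat.prime_iff_prime_int.mp hp) hqk hl with hd | hd
  · rwa [← quadClass_congr ω hd]
  · rw [← quadClass_congr ω hd, h.quadClass_conj hq0 hqk, inv_pow]
    exact inv_mem key

theorem nonempty_sylow_mulEquiv (h : IsImagQuadOrder ω ε n) [Finite (ClassGroup R)]
    {c : ThreeClassCert} (hc : c.check ε n = true) (P : Sylow 3 (ClassGroup R)) :
    Nonempty (P ≃* Multiplicative (ZMod 3 × ZMod 3)) := by
  simp only [ThreeClassCert.check, Bool.and_eq_true, Nat.blt_eq, decide_eq_true_eq,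
    Bool.not_eq_true', beq_eq_false_iff_ne, List.all_eq_true] at hc
  obtain ⟨⟨⟨⟨⟨⟨⟨⟨⟨⟨hB, hdisc⟩, hm⟩, hx⟩, hy⟩, hrx⟩, hry⟩, hxy⟩, hxy'⟩, hbase⟩, hrels⟩ := hc
  obtain ⟨ha, hak, hx3⟩ := h.of_isCubeTrivial hx
  obtain ⟨hb, hbl, hy3⟩ := h.of_isCubeTrivial hy
  obtain ⟨hz, hrz⟩ := h.of_isProduct ha hb hxy
  obtain ⟨hw, hrw⟩ := h.of_isProduct ha hb hxy'
  rw [h.quadClass_conj hb.ne' hbl] at hw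
  have hx1 := h.quadClass_quadReduce 1000 ha hak
  have hy1 := h.quadClass_quadReduce 1000 hb hbl
  have hxE : quadClass ω c.a c.k ∈ Subgroup.closure {quadClass ω c.a c.k, quadClass ω c.b c.l} :=
    Subgroup.subset_closure (by simp)
  have hyE : quadClass ω c.b c.l ∈ Subgroup.closure {quadClass ω c.a c.k, quadClass ω c.b c.l} :=
    Subgroup.subset_closure (by simp)
  refine nonempty_sylow_three_mulEquiv hx3 hy3 (hx1 ▸ h.ne_one_of_isReduced hrx)
    (hy1 ▸ h.ne_one_of_isReduced hry) (hz ▸ h.ne_one_of_isReduced hrz)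
    (hw ▸ h.ne_one_of_isReduced hrw)
    ((Nat.coprime_comm.mp ((Nat.Prime.coprime_iff_not_dvd Nat.prime_three).mpr
      fun hd => hm (Nat.mod_eq_zero_of_dvd hd)))) ?_ P
  generalize Subgroup.closure {quadClass ω c.a c.k, quadClass ω c.b c.l} = E at hxE hyE
  refine h.mem_of_forall_prime (E.comap (powMonoidHom c.m)) fun p hp hle k hk => ?_
  refine h.mem_of_checkPrimes _ hB c.rels _ ?_ hrels hp ?_ hk
  · intro q hq
    obtain ⟨⟨q, r⟩, hqr, rfl⟩ := List.mem_map.mp hq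
    have hqm := hbase _ hqr
    refine ⟨?_, fun l hl => h.of_isPowMem E ?_ (by rintro e; simp [e] at hm) hqm hl⟩
    · simp only [isPowMem, Bool.and_eq_true] at hqm
      exact (prime_of_isSmallPrime hqm.1.1).ne_zero
    · simp only [List.mem_cons, List.not_mem_nil, or_false, forall_eq_or_imp, forall_eq]
      exact ⟨⟨hrx, hx1 ▸ hxE⟩, ⟨hry, hy1 ▸ hyE⟩, ⟨hrz, hz ▸ mul_mem hxE hyE⟩,
        ⟨hrw, hw ▸ mul_mem hxE (inv_mem hyE)⟩⟩
  · by_contra hlt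
    push Not at hlt
    have : ((c.B + 1 : ℕ) : ℤ) ≤ p := by exact_mod_cast hlt
    nlinarith [Int.natCast_nonneg (c.B + 1)]

end IsImagQuadOrder

/-- A test for `D` with `|D| < 10 ^ 6` to be a fundamental discriminant, given `D % 4 ≤ 1`. -/
def isFundamental (D : ℤ) : Bool :=
  decide (D < 0) && decide (-1000000 < D) && !(D % 16 == 0) && !(D % 16 == 4) &&
    (List.range 1000).all fun q => Nat.blt q 3 || !(D % (q * q : ℕ) == 0)

theorem not_sq_dvd_of_isFundamental {D : ℤ} (h : isFundamental D = true) {q : ℕ} (hq : 3 ≤ q) :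
    ¬ (q : ℤ) * q ∣ D := by
  simp only [isFundamental, Bool.and_eq_true, decide_eq_true_eq, Bool.not_eq_true',
    beq_eq_false_iff_ne, List.all_eq_true, List.mem_range, Bool.or_eq_true, Nat.blt_eq] at h
  obtain ⟨⟨⟨⟨h1, h2⟩, -⟩, -⟩, h3⟩ := h
  intro hd
  have hle : (q : ℤ) * q ≤ -D := Int.le_of_dvd (by omega) (hd.neg_right)
  have hlt : q < 1000 := by
    by_contra hc
    have : (1000 : ℤ) ≤ q := by exact_mod_cast not_lt.mp hc
    nlinarith
  refine (h3 q hlt).elim (fun h => by omega) fun h => h ?_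
  push_cast
  exact Int.emod_eq_zero_of_dvd hd

theorem mul_sq_emod {x : ℤ} (y : ℤ) (hx : x % 4 = 0 ∨ x % 4 = 1) :
    4 * (x * (y * y)) % 16 = 0 ∨ 4 * (x * (y * y)) % 16 = 4 := by
  have : x * (y * y) % 4 = 0 ∨ x * (y * y) % 4 = 1 := by
    have hy : y * y % 4 = 0 ∨ y * y % 4 = 1 := by
      rcases Int.emod_two_eq_zero_or_one y with h | h <;>
      obtain ⟨z, hz⟩ : ∃ z, y = 2 * z + y % 2 := ⟨y / 2, by omega⟩ <;> rw [h] at hz <;> subst hz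
      · left; ring_nf; omega
      · right; ring_nf; omega
    rcases hx with h | h <;> rcases hy with h' | h' <;> rw [Int.mul_emod, h, h'] <;> norm_num
  omega

/-- If `t² - D s²` is divisible by `4` with `D` a fundamental discriminant, then `s` is integral. -/
theorem den_eq_one_of_isFundamental {D : ℤ} (h : isFundamental D = true) {s : ℚ} {t m : ℤ}
    (hs : (t : ℚ) * t - D * (s * s) = 4 * m) : s.den = 1 := by
  have e1 : (D : ℚ) * (s.num * s.num) = (t * t - 4 * m) * (s.den * s.den) := by
    rw [← Rat.mul_den_eq_num s]
    linear_combination -((s.den : ℚ) * s.den) * hs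
  have e2 : D * (s.num * s.num) = (t * t - 4 * m) * ((s.den : ℤ) * s.den) := by exact_mod_cast e1
  have hc : IsCoprime ((s.den : ℤ)) s.num :=
    (Int.isCoprime_iff_nat_coprime.mpr (by simpa using s.reduced)).symm
  have hdvd : (s.den : ℤ) * s.den ∣ D :=
    ((hc.mul_left hc).mul_right (hc.mul_left hc)).dvd_of_dvd_mul_right
      ⟨t * t - 4 * m, by rw [e2]; ring⟩
  have hlt : s.den < 3 := by
    by_contra hcon
    exact not_sq_dvd_of_isFundamental h (not_lt.mp hcon) hdvd
  have hpos := s.den_pos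
  interval_cases hd : s.den
  · rfl
  exfalso
  obtain ⟨x, rfl⟩ := hdvd
  have hodd : s.num % 2 = 1 := by
    by_contra hcon
    have h2 : (2 : ℤ) ∣ s.num := by omega
    have := hc.isUnit_of_dvd' (x := 2) (by norm_num) h2
    rw [Int.isUnit_iff] at this
    omega
  have e3 : x * (s.num * s.num) = t * t - 4 * m := by
    push_cast at e2
    linarith
  have hx : x % 4 = 0 ∨ x % 4 = 1 := by
    obtain ⟨z, hz⟩ : ∃ z, s.num = 2 * z + 1 := ⟨s.num / 2, by omega⟩
    rw [hz] at e3
    rcases mul_sq_emod (x := 1) t (by norm_num) with h' | h' <;>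
    · have e4 : x = t * t - 4 * m - 4 * (x * z * z + x * z) := by linear_combination e3
      omega
  have := mul_sq_emod 1 hx
  simp only [isFundamental, Bool.and_eq_true, decide_eq_true_eq, Bool.not_eq_true',
    beq_eq_false_iff_ne] at h
  push_cast at h
  omega

theorem isIntegral_of_sq {A : Type*} [CommRing A] {x : A} {p q : ℤ} (h : x * x + p * x + q = 0) :
    IsIntegral ℤ x := by
  nontriviality A
  refine ⟨Polynomial.X ^ 2 + Polynomial.C p * Polynomial.X + Polynomial.C q, by monicity!, ?_⟩
  simp only [Polynomial.eval₂_add, Polynomial.eval₂_mul, Polynomial.eval₂_C, Polynomial.eval₂_X,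
    Polynomial.eval₂_pow]
  simp only [eq_intCast]
  linear_combination h

theorem exists_sq_of_isIntegral {K : Type*} [Field K] [NumberField K]
    (hK : Module.finrank ℚ K = 2) {x : K} (hx : IsIntegral ℤ x) :
    (∃ c : ℤ, x = c) ∨ ∃ p q : ℤ, x * x + p * x + q = 0 := by
  have h1 : (minpoly ℤ x).natDegree ≤ 2 := by
    have := minpoly.natDegree_le (A := ℚ) x
    rw [minpoly.isIntegrallyClosed_eq_field_fractions' ℚ hx,
      (minpoly.monic hx).natDegree_map, hK] at this
    exact this
  have hm := minpoly.monic hx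
  have h0 := minpoly.aeval ℤ x
  rw [Polynomial.aeval_eq_sum_range] at h0
  have hpos := minpoly.natDegree_pos hx
  have hlc : (minpoly ℤ x).coeff (minpoly ℤ x).natDegree = 1 := hm
  interval_cases hd : (minpoly ℤ x).natDegree
  · left
    refine ⟨-(minpoly ℤ x).coeff 0, ?_⟩
    simp only [Finset.sum_range_succ, Finset.sum_range_zero, hlc] at h0
    simp at h0
    push_cast
    linear_combination h0
  · right
    refine ⟨(minpoly ℤ x).coeff 1, (minpoly ℤ x).coeff 0, ?_⟩
    simp only [Finset.sum_range_succ, Finset.sum_range_zero, hlc] at h0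
    simp at h0
    linear_combination h0

section NumberField

variable {K : Type*} [Field K] [NumberField K] {w : K} {ε n : ℤ}

theorem eq_zero_of_add_mul_eq_zero (hw : w * w = ε * w - n) (hD : ε * ε - 4 * n < 0) {r s : ℚ}
    (h : (r : K) + s * w = 0) : r = 0 ∧ s = 0 := by
  have hs : s = 0 := by
    by_contra hs
    have hs' : (s : K) ≠ 0 := by exact_mod_cast hs
    have e : w = ((-r / s : ℚ) : K) := by
      push_cast
      field_simp
      linear_combination h
    rw [e] at hw
    have e2 : (-r / s) * (-r / s) = ε * (-r / s) - n := by exact_mod_cast hw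
    have e3 : (2 * (-r / s) - ε) * (2 * (-r / s) - ε) = ((ε * ε - 4 * n : ℤ) : ℚ) := by
      push_cast
      linear_combination 4 * e2
    have : ((ε * ε - 4 * n : ℤ) : ℚ) < 0 := by exact_mod_cast hD
    linarith [mul_self_nonneg (2 * (-r / s) - (ε : ℚ))]
  subst hs
  simpa using h

theorem exists_rat_eq (hK : Module.finrank ℚ K = 2) (hw : w * w = ε * w - n)
    (hD : ε * ε - 4 * n < 0) (x : K) : ∃ r s : ℚ, x = r + s * w := by
  have hli : LinearIndependent ℚ ![(1 : K), w] := by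
    rw [LinearIndependent.pair_iff]
    intro r s h
    exact eq_zero_of_add_mul_eq_zero hw hD (by simpa [Algebra.smul_def] using h)
  have hspan := hli.span_eq_top_of_card_eq_finrank' (by simp [hK])
  have hx : x ∈ Submodule.span ℚ (Set.range ![(1 : K), w]) := hspan ▸ Submodule.mem_top
  rw [Matrix.range_cons, Matrix.range_cons, Matrix.range_empty, Set.union_empty,
    Set.singleton_union, Submodule.mem_span_pair] at hx
  obtain ⟨r, s, rfl⟩ := hx
  exact ⟨r, s, by simp [Algebra.smul_def]⟩

theorem exists_int_eq (hK : Module.finrank ℚ K = 2) (hw : w * w = ε * w - n)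
    (hf : isFundamental (ε * ε - 4 * n) = true) (hD : ε * ε - 4 * n < 0) {x : K}
    (hx : IsIntegral ℤ x) : ∃ u v : ℤ, x = u + v * w := by
  obtain ⟨c, rfl⟩ | ⟨p, q, hpq⟩ := exists_sq_of_isIntegral hK hx
  · exact ⟨c, 0, by simp⟩
  obtain ⟨r, s, rfl⟩ := exists_rat_eq hK hw hD x
  have key := eq_zero_of_add_mul_eq_zero (r := r * r - s * s * n + p * r + q)
    (s := s * (2 * r + ε * s + p)) hw hD (by
      push_cast
      linear_combination hpq - (s : K) * s * hw)
  obtain ⟨k1, k2⟩ := key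
  have hsd : s.den = 1 := by
    rcases mul_eq_zero.mp k2 with rfl | k2
    · rfl
    refine den_eq_one_of_isFundamental hf (t := -p) (m := q) ?_
    push_cast
    linear_combination (2 * r - s * ε + p) * k2 - 4 * k1
  obtain ⟨v, rfl⟩ : ∃ v : ℤ, s = v := ⟨s.num, (Rat.den_eq_one_iff s).mp hsd |>.symm⟩
  have hr : ∃ u : ℤ, r = u := by
    have hint : IsIntegral ℤ r := by
      refine isIntegral_of_sq (p := p) (q := q - v * v * n) ?_
      push_cast
      linear_combination k1
    obtain ⟨u, hu⟩ := IsIntegrallyClosed.isIntegral_iff.mp hint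
    exact ⟨u, by simpa using hu.symm⟩
  obtain ⟨u, rfl⟩ := hr
  exact ⟨u, v, by simp⟩

open NumberField in
theorem exists_isImagQuadOrder (hK : Module.finrank ℚ K = 2) {α : K}
    (hα : α ^ 2 = ((ε * ε - 4 * n : ℤ) : K)) (hf : isFundamental (ε * ε - 4 * n) = true) :
    ∃ ω : 𝓞 K, IsImagQuadOrder ω ε n := by
  have hD : ε * ε - 4 * n < 0 := by
    simp only [isFundamental, Bool.and_eq_true, decide_eq_true_eq] at hf
    exact hf.1.1.1.1
  obtain ⟨w, hw⟩ : ∃ w : K, w * w = ε * w - n := by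
    refine ⟨(ε + α) / 2, ?_⟩
    push_cast at hα
    linear_combination hα / 4
  have hint : IsIntegral ℤ w := by
    refine isIntegral_of_sq (p := -ε) (q := n) ?_
    push_cast
    linear_combination hw
  obtain ⟨ω, rfl⟩ : ∃ ω : 𝓞 K, (ω : K) = w := ⟨⟨w, hint⟩, rfl⟩
  refine ⟨ω, ?_, ?_, ?_, hD, ?_⟩
  · apply RingOfIntegers.ext
    simpa using hw
  · intro x
    obtain ⟨u, v, h⟩ := exists_int_eq hK hw hf hD x.isIntegral_coe
    exact ⟨u, v, RingOfIntegers.ext (by simpa using h)⟩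
  · intro u v h
    have h' : ((u : ℚ) : K) + (v : ℚ) * (ω : K) = 0 := by
      simpa using congrArg (algebraMap (𝓞 K) K) h
    exact_mod_cast eq_zero_of_add_mul_eq_zero hw hD h'
  · intro q hq k h1 h2
    have e : ε * ε - 4 * n = (2 * k + ε) * (2 * k + ε) - 4 * quadVal ε n k := by
      unfold quadVal
      ring
    rcases hq.two_le.eq_or_lt with rfl | hq3
    · obtain ⟨f, hf1⟩ := h1
      obtain ⟨g, hg⟩ := h2
      have := mul_sq_emod (x := 1) g (by norm_num)
      simp only [isFundamental, Bool.and_eq_true, decide_eq_true_eq, Bool.not_eq_true',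
        beq_eq_false_iff_ne] at hf
      rw [e, hf1, hg] at hf
      have e' : ((2 : ℕ) : ℤ) * g * ((2 : ℕ) * g) - 4 * ((2 : ℕ) * (2 : ℕ) * f) =
        4 * (1 * (g * g)) - 16 * f := by push_cast; ring
      rw [e'] at hf
      omega
    · exact not_sq_dvd_of_isFundamental hf hq3
        (e ▸ dvd_sub (mul_dvd_mul h2 h2) (h1.mul_left 4))

end NumberField

/-- A certificate for the discriminant `-291220`. -/
def cert291220 : ThreeClassCert where
  B := 311
  m := 8
  a := 161
  k := -834963
  b := 181
  l := -987987
  i := 12219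
  j := 7872
  base :=
    [(7, -1705638), (11, -26793050), (23, 11057325492)]
  rels :=
    [(2, -101, [7, 7, 7, 11, 11]), (5, -20, [11, 11, 11, 11]), (31, 75, [11, 23, 2, 5]),
     (37, 199, [7, 7, 2, 31]), (53, -297, [7, 7, 2, 31]), (59, 60, [7, 5, 37]),
     (67, -52, [7, 7, 23]), (73, 80, [7, 5, 31]), (83, -144, [7, 7, 23]), (101, -97, [11, 2, 37]),
     (103, 4, [7, 101]), (107, 13, [11, 2, 31]), (109, 15, [2, 5, 67]), (139, 46, [7, 7, 11]),
     (151, 66, [7, 73]), (163, -120, [5, 107]), (167, -95, [7, 7, 2, 5]),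
     (179, 255, [7, 11, 2, 5]), (181, 270, [7, 23, 5]), (197, -171, [7, 2, 37]),
     (199, 32, [7, 53]), (211, 74, [7, 53]), (223, 89, [2, 181]), (227, 17, [7, 23, 2]),
     (229, 43, [2, 163]), (233, 103, [2, 179]), (239, -125, [2, 5, 37]), (263, 109, [7, 23, 2]),
     (293, 93, [2, 139]), (311, 88, [7, 37])]

/-- A certificate for the discriminant `-633352`. -/
def cert633352 : ThreeClassCert where
  B := 459
  m := 4
  a := 83
  k := 643
  b := 179
  l := 2293869
  i := 1058
  j := -3922
  base :=
    [(7, 521), (31, 48374), (41, 1095932)]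
  rels :=
    [(2, -80, [7, 7, 41, 41]), (73, -1068, [7, 31, 41, 2]), (83, 851, [7, 7, 7, 31]),
     (101, -265, [31, 73]), (103, -1515, [7, 41, 83]), (113, 38, [7, 2, 101]),
     (127, 1060, [7, 7, 2, 103]), (131, 164, [7, 2, 101]), (137, 324, [31, 31, 2]),
     (139, 298, [7, 2, 127]), (149, 603, [31, 113]), (157, 46, [7, 2, 73]), (173, -87, [7, 137]),
     (179, -521, [7, 7, 7, 7]), (181, 228, [7, 2, 83]), (191, 192, [7, 2, 73]),
     (199, 270, [7, 2, 83]), (211, -171, [7, 127]), (227, 73, [7, 103]), (229, -151, [7, 113]),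
     (233, 291, [7, 149]), (241, 305, [7, 149]), (257, -409, [7, 181]), (269, 598, [7, 2, 137]),
     (277, -178, [7, 7, 7, 2]), (337, 64, [2, 241]), (347, 58, [2, 233]), (349, -641, [7, 233]),
     (353, 152, [2, 257]), (359, 78, [2, 229]), (379, 40, [2, 211]), (383, -248, [7, 41, 2]),
     (397, 907, [7, 353]), (401, 154, [2, 227]), (431, 113, [397]), (433, 172, [7, 31, 2]),
     (439, 128, [2, 199]), (443, 16, [2, 179]), (457, 200, [7, 31, 2]), (17, -119, [73, 139]),
     (43, 17, [7, 31, 17])]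

/-- A certificate for the discriminant `-874680`. -/
def cert874680 : ThreeClassCert where
  B := 539
  m := 4
  a := 289
  k := -6035528
  b := 361
  l := -17642924
  i := -11323
  j := -47159
  base :=
    [(13, -5911), (17, 22016), (19, -49589), (31, -461650)]
  rels :=
    [(37, -1517, [13, 13, 13, 31]), (47, -407, [13, 17, 37]), (61, -341, [17, 17, 19]),
     (109, 1331, [19, 31, 31]), (167, -157, [31, 47]), (199, -1159, [47, 167]),
     (211, -761, [19, 199]), (229, 463, [31, 61]), (239, 1733, [13, 17, 61]),
     (241, -911, [19, 229]), (283, 919, [13, 17, 17]), (313, 37, [19, 37]), (367, -269, [13, 61]),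
     (449, -1291, [13, 17, 19]), (461, -251, [13, 47]), (2, -56, [13, 19, 449]),
     (3, -132, [19, 19, 109, 2]), (5, -35, [13, 17, 199]), (71, -204, [13, 47, 2, 3]),
     (73, -555, [13, 37, 3, 5]), (79, 9, [13, 3, 71]), (97, 29, [31, 73]), (101, 147, [13, 61, 3]),
     (113, 18, [17, 19, 2, 3]), (131, 10, [167, 2, 5]), (137, 16, [17, 47, 2]),
     (139, 33, [17, 31, 3]), (157, 195, [109, 3, 5]), (179, -151, [19, 71]), (191, 5, [229, 5]),
     (193, -305, [17, 19, 5]), (197, 0, [37, 2, 3, 5]), (233, 74, [13, 37, 2]),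
     (277, 393, [449, 3]), (311, 98, [367, 2]), (317, 80, [2, 5, 71]), (331, -320, [2, 5, 97]),
     (337, 69, [13, 17, 3]), (347, -258, [2, 3, 137]), (349, 159, [3, 233]),
     (359, -252, [2, 3, 131]), (383, 52, [17, 17, 2]), (389, 81, [3, 193]),
     (401, 156, [2, 3, 101]), (419, 116, [2, 277]), (431, -268, [2, 337]), (439, 55, [5, 101]),
     (457, 120, [17, 2, 3, 5]), (479, 134, [13, 19, 2]), (487, 207, [3, 179]),
     (491, 110, [47, 2, 5]), (499, 177, [167, 3]), (523, 102, [2, 3, 73])]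

/-- A certificate for the discriminant `-731867`. -/
def cert731867 : ThreeClassCert where
  B := 493
  m := 26
  a := 69
  k := 381
  b := 203
  l := -2861
  i := -6312
  j := 6108
  base :=
    [(3, -420732375819), (7, -1981704479015043542387)]
  rels :=
    [(37, 1488, [3, 3, 3, 7, 7, 7, 7]), (47, 489, [3, 3, 3, 3, 3, 37]),
     (53, 165, [3, 3, 3, 3, 7, 7]), (71, 1562, [3, 3, 3, 37, 37]), (83, 19, [47, 47]),
     (89, -157, [3, 3, 7, 37]), (97, -186, [3, 3, 3, 83]), (101, -1173, [3, 53, 97]),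
     (107, -418, [3, 3, 7, 53]), (127, 667, [7, 7, 101]), (139, 30, [3, 3, 3, 7, 7]),
     (157, -1050, [3, 3, 3, 3, 101]), (167, 396, [3, 7, 97]), (173, 361, [7, 7, 37]),
     (179, 264, [3, 3, 157]), (191, 74, [3, 7, 47]), (223, -141, [3, 3, 101]),
     (229, 21, [3, 3, 89]), (233, -204, [3, 3, 107]), (241, 65, [3, 7, 37]),
     (251, 3, [3, 3, 3, 3, 3, 3]), (263, 29, [3, 233]), (281, 88, [7, 97]),
     (349, 746, [3, 7, 101]), (353, 15, [3, 173]), (367, 158, [3, 3, 3, 3, 7]),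
     (373, 62, [3, 167]), (379, -370, [3, 281]), (383, -307, [3, 241]), (397, -640, [3, 7, 71]),
     (409, 142, [7, 71]), (421, 188, [3, 173]), (439, -269, [7, 83]), (443, 66, [3, 3, 47]),
     (463, 113, [3, 3, 47]), (467, 108, [3, 139]), (479, 206, [3, 157]), (17, -9, [3, 37, 97]),
     (23, 9, [3, 7, 379]), (29, 39, [3, 3, 7, 101]), (43, 18, [3, 7, 7, 29]), (59, 10, [107, 29])]

/-- A certificate for the discriminant `-507140`. -/
def cert507140 : ThreeClassCert where
  B := 411
  m := 20
  a := 309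
  k := 11347331
  b := 901
  l := 9752493
  i := 58634
  j := 117962
  base :=
    [(3, -1057071749), (11, -161585997469103173999), (13, 1069687309093645459739)]
  rels :=
    [(5, -230, [3, 3, 3, 11, 11, 11]), (17, -50, [3, 3, 13, 13, 5]), (31, 254, [3, 11, 11, 17]),
     (47, 392, [3, 3, 3, 13, 17]), (53, 16, [3, 17, 47]), (61, -956, [3, 11, 11, 47]),
     (73, -142, [3, 11, 61]), (79, 180, [13, 5, 31]), (89, 118, [3, 17, 31]),
     (97, -364, [3, 3, 3, 3, 3, 11]), (101, 24, [13, 97]), (103, -76, [3, 3, 11, 13]),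
     (107, -170, [3, 5, 97]), (113, -338, [3, 3, 3, 79]), (127, 56, [3, 11, 31]),
     (137, -112, [3, 3, 113]), (139, 20, [3, 5, 61]), (151, -120, [11, 5, 17]),
     (157, 68, [3, 3, 3, 31]), (173, -102, [13, 61]), (179, 22, [3, 3, 79]),
     (191, -1064, [3, 13, 13, 13]), (193, 4, [3, 3, 73]), (197, -110, [3, 5, 47]),
     (199, 464, [3, 3, 191]), (227, -154, [3, 13, 17]), (229, -220, [3, 3, 5, 17]),
     (233, 82, [3, 191]), (239, -210, [11, 13, 5]), (251, -1220, [3, 3, 11, 13, 5]),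
     (257, 78, [11, 47]), (263, -490, [3, 3, 5, 31]), (277, -268, [3, 239]), (293, 60, [5, 89]),
     (307, -518, [3, 3, 11, 13]), (317, 40, [3, 3, 3, 3, 5]), (331, -536, [3, 3, 139]),
     (353, -182, [3, 151]), (359, -244, [3, 173]), (379, 524, [3, 353]), (397, -332, [3, 199]),
     (401, 44, [3, 107]), (409, 150, [5, 73]), (2, -1, [3, 11, 17, 113])]

/-- A certificate for the discriminant `-578847`. -/
def cert578847 : ThreeClassCert where
  B := 439
  m := 52
  a := 58
  k := 224
  b := 91
  l := -376577
  i := -1748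
  j := 746
  base :=
    [(2, 584289845686904), (7, -42721974158720113052884395369675281535321852)]
  rels :=
    [(13, 135, [2, 2, 2, 2, 2, 2, 2, 2, 7, 7]), (19, 632, [2, 2, 2, 2, 2, 2, 2, 2, 2, 2, 2, 2, 7]),
     (29, -747, [2, 7, 7, 13, 19]), (31, 44, [2, 2, 7, 13, 13]),
     (41, 423, [2, 2, 2, 2, 2, 13, 19]), (67, 95, [2, 2, 2, 7, 41]), (71, -109, [2, 2, 19, 29]),
     (79, 33, [2, 13, 71]), (83, 195, [2, 2, 19, 29]), (89, -177, [2, 2, 2, 13, 19]),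
     (97, -385, [2, 2, 2, 13, 29]), (101, -576, [2, 2, 2, 19, 31]), (103, 30, [2, 7, 101]),
     (107, -88, [2, 2, 2, 2, 89]), (113, -94, [2, 7, 97]), (127, 53, [2, 7, 83]),
     (137, 32, [2, 2, 2, 7, 19]), (157, -151, [2, 13, 41]), (179, -460, [2, 2, 7, 71]),
     (181, -153, [2, 2, 2, 2, 2, 29]), (197, -124, [2, 2, 7, 29]), (211, 252, [2, 2, 13, 19]),
     (227, -139, [2, 19, 19]), (239, 24, [2, 2, 2, 2, 2, 19]), (263, 392, [2, 2, 2, 2, 71]),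
     (269, -223, [2, 19, 19]), (271, 272, [2, 2, 2, 101]), (277, 51, [2, 2, 7, 19]),
     (293, 5, [2, 13, 19]), (307, 129, [2, 263]), (311, 120, [2, 2, 2, 2, 2, 2, 2, 2, 2]),
     (347, 41, [2, 211]), (349, 168, [2, 2, 2, 2, 31]), (353, -226, [2, 277]),
     (359, 132, [2, 2, 113]), (367, 65, [2, 7, 29]), (373, 3, [2, 2, 97]), (401, 131, [2, 2, 101]),
     (421, 77, [2, 179]), (431, 171, [2, 2, 101]), (433, 101, [2, 179]), (3, -2, [2, 89, 271])]

/-- A certificate for the discriminant `-167064`. -/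
def cert167064 : ThreeClassCert where
  B := 235
  m := 8
  a := 55
  k := -353
  b := 127
  l := -292620
  i := 2782
  j := -1893
  base :=
    [(5, 15397), (11, 91767479), (13, -6797878)]
  rels :=
    [(2, -22, [5, 5, 5, 13, 13]), (3, -147, [5, 5, 5, 13, 13]), (23, -87, [5, 11, 13, 3]),
     (29, -78, [5, 5, 11, 2, 3]), (37, 9, [13, 3, 29]), (47, 102, [5, 2, 3, 37]),
     (61, 18, [5, 2, 3, 23]), (79, 5, [23, 23]), (89, 8, [5, 2, 47]), (103, -84, [2, 3, 79]),
     (113, 48, [5, 13, 2, 3]), (127, 12, [5, 11, 2, 3]), (137, -108, [5, 13, 2, 3]),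
     (149, 38, [5, 2, 29]), (157, 56, [11, 13, 2]), (173, 10, [11, 11, 2]), (181, 81, [3, 89])]

/-- A certificate for the discriminant `-296407`. -/
def cert296407 : ThreeClassCert where
  B := 314
  m := 22
  a := 67
  k := -150349
  b := 71
  l := 178831
  i := 1473
  j := 2076
  base :=
    [(2, -635930), (7, 746702640305865089)]
  rels :=
    [(41, -1050, [2, 2, 2, 2, 2, 2, 2, 2, 2, 2, 2, 2, 7]), (43, -210, [2, 2, 2, 7, 7, 7]),
     (59, -58, [2, 2, 2, 2, 2, 41]), (67, -134, [2, 2, 7, 7, 7]),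
     (71, 230, [2, 2, 2, 2, 2, 2, 2, 2, 7]), (73, 25, [2, 2, 2, 2, 2, 2, 2, 2, 2, 2]),
     (79, 0, [2, 7, 67]), (83, -302, [2, 2, 7, 71]), (97, 196, [2, 7, 83]),
     (107, -95, [2, 2, 2, 97]), (109, 153, [2, 2, 2, 2, 2, 2, 2, 7]), (113, 30, [2, 2, 2, 83]),
     (127, 48, [2, 7, 43]), (131, 17, [2, 2, 2, 71]), (137, -92, [2, 7, 43]),
     (139, 45, [2, 2, 137]), (149, -94, [2, 2, 139]), (157, 1, [2, 2, 2, 59]),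
     (163, -140, [2, 7, 41]), (167, -148, [2, 7, 41]), (179, 82, [2, 2, 113]),
     (191, 2, [2, 2, 97]), (199, 62, [2, 2, 2, 7, 7]), (223, 19, [2, 167]), (229, 23, [2, 163]),
     (233, 96, [2, 179]), (239, 65, [2, 2, 2, 41]), (271, 53, [2, 2, 71]), (293, 66, [2, 2, 67]),
     (307, -178, [2, 2, 2, 43]), (313, 155, [2, 157]), (37, -56, [2, 7, 149])]

/-- A certificate for the discriminant `-317747`. -/
def cert317747 : ThreeClassCert where
  B := 325
  m := 20
  a := 117
  k := -400260
  b := 443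
  l := 6210482
  i := -7023
  j := -23988
  base :=
    [(3, -1345938888), (7, -21823397344075941)]
  rels :=
    [(37, 38, [3, 3, 3, 3, 3, 3, 3]), (101, 146, [3, 3, 3, 37]), (109, -73, [3, 7, 37]),
     (131, 149, [3, 7, 37]), (137, 459, [3, 7, 101]), (167, -124, [3, 3, 3, 3, 7]),
     (199, 48, [3, 137]), (211, -201, [3, 3, 3, 3, 7]), (223, -138, [3, 3, 7, 7]),
     (227, 923, [3, 37, 37]), (269, 45, [3, 101]), (277, -186, [3, 137]), (293, -1442, [37, 199]),
     (313, 360, [3, 223]), (317, 91, [277]), (13, 15, [3, 3, 3, 227]), (17, -315, [3, 269, 13]),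
     (19, -37, [3, 109, 13]), (29, 10, [211, 13]), (43, 55, [101, 19]),
     (59, -43, [3, 3, 3, 3, 17]), (71, -68, [7, 13, 13]), (89, 30, [3, 7, 43]),
     (97, 2, [3, 3, 7, 13]), (103, 116, [3, 7, 43]), (113, 1, [37, 19]), (139, 153, [3, 13, 19]),
     (173, 76, [17, 29]), (191, 14, [3, 139]), (193, 16, [7, 59]), (257, 115, [19, 19]),
     (271, 111, [3, 113]), (281, -145, [3, 7, 17]), (283, 89, [3, 103]), (307, 99, [3, 97])]

/-- A certificate for the discriminant `-401603`. -/
def cert401603 : ThreeClassCert where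
  B := 365
  m := 8
  a := 47
  k := -59
  b := 123
  l := 929829
  i := -1281
  j := -811
  base :=
    [(3, 1488), (7, 763959)]
  rels :=
    [(41, -442, [3, 7, 7, 7, 7]), (43, 482, [3, 3, 3, 7, 41]), (47, 293, [3, 3, 3, 3, 7, 7]),
     (67, -1582, [3, 7, 43, 43]), (103, 35, [3, 7, 47]), (107, -99, [3, 7, 7, 7]),
     (113, -106, [3, 7, 47]), (127, 7, [7, 113]), (131, 810, [3, 41, 47]), (137, -133, [3, 7, 41]),
     (139, 30, [3, 3, 3, 3, 3, 3]), (157, -429, [3, 3, 3, 67]), (167, 224, [3, 7, 43]),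
     (181, -94, [3, 3, 67]), (199, 87, [3, 181]), (233, 48, [3, 3, 7, 7]), (241, 114, [3, 157]),
     (257, 24, [3, 131]), (269, 108, [3, 139]), (277, 129, [3, 3, 47]), (283, 95, [3, 3, 43]),
     (293, 141, [3, 137]), (307, 113, [3, 3, 41]), (311, 134, [3, 127]), (313, 8, [3, 107]),
     (317, 155, [3, 131]), (353, 76, [7, 43]), (19, -10, [3, 41, 43]), (23, -58, [3, 3, 3, 167]),
     (31, 11, [3, 47, 23])]

/-- A certificate for the discriminant `-588027`. -/
def cert588027 : ThreeClassCert where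
  B := 442
  m := 4
  a := 133
  k := -588154
  b := 229
  l := 1334367
  i := -11466
  j := -5481
  base :=
    [(7, 777), (19, 53151), (29, -247041), (41, -1108705), (43, 1690300)]
  rels :=
    [(61, 84, [7, 19, 19]), (79, 714, [7, 29, 41]), (83, -141, [7, 7, 41]), (89, 99, [41, 43]),
     (101, 633, [61, 89]), (109, -288, [7, 7, 43]), (113, 228, [41, 43]), (149, 1497, [7, 29, 79]),
     (151, -847, [7, 19, 43]), (163, -313, [19, 79]), (167, -301, [7, 7, 29]),
     (173, -1644, [101, 163]), (181, 29, [19, 43]), (199, 69, [7, 109]), (211, -546, [7, 7, 43]),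
     (229, -214, [29, 29]), (251, -175, [7, 101]), (257, -417, [29, 43]), (281, -168, [7, 89]),
     (293, -189, [7, 89]), (313, -162, [7, 79]), (347, 1091, [7, 19, 29]),
     (359, 1112, [7, 19, 29]), (367, 98, [7, 61]), (373, 447, [7, 7, 19]), (383, -1105, [43, 83]),
     (389, 44, [383]), (409, 74, [373]), (431, 50, [347]), (433, 1892, [79, 109]),
     (3, -11, [19, 29, 89]), (11, -28, [7, 19, 101]), (47, 7, [7, 149, 3]), (59, 23, [41, 61]),
     (73, -127, [7, 29, 11]), (103, -155, [7, 79, 3])]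

/-- A certificate for the discriminant `-591412`. -/
def cert591412 : ThreeClassCert where
  B := 444
  m := 26
  a := 53
  k := 32
  b := 113
  l := -1138
  i := -1929
  j := 1251
  base :=
    [(7, 4268204670003026379992), (11, 309603020819114672705821329),
     (13, 115319370120587716586689982), (17, -46878324787423224965643970572061)]
  rels :=
    [(2, -239, [7, 11, 11, 11, 11]), (19, -162, [7, 7, 11, 17]), (37, 43, [7, 17, 17, 2]),
     (43, -29, [7, 13, 2, 19]), (47, 3, [11, 11, 13, 2]), (53, -85, [7, 11, 2, 19]),
     (59, -117, [2, 37, 37]), (67, 138, [47, 53]), (71, -124, [11, 11, 19]),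
     (97, -181, [7, 7, 2, 19]), (103, -63, [11, 2, 67]), (109, 13, [7, 2, 97]),
     (113, 8, [7, 11, 17]), (131, -96, [11, 109]), (137, -229, [17, 2, 43]),
     (149, 36, [7, 11, 13]), (151, 60, [17, 59]), (163, 71, [7, 2, 67]), (179, 1, [7, 2, 59]),
     (191, -118, [7, 11, 11]), (199, -197, [7, 2, 67]), (211, 67, [2, 19, 19]),
     (229, 9, [17, 2, 19]), (233, 58, [11, 59]), (239, 97, [7, 2, 47]), (241, -230, [7, 7, 17]),
     (251, 57, [7, 2, 43]), (263, 74, [11, 53]), (269, -161, [17, 2, 19]), (307, 11, [2, 241]),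
     (313, 14, [11, 43]), (317, 68, [13, 37]), (331, -249, [2, 317]), (349, 160, [7, 71]),
     (359, 47, [11, 2, 19]), (379, 80, [11, 37]), (383, 175, [2, 233]), (397, 25, [11, 17, 2]),
     (401, 73, [2, 191]), (409, -253, [7, 2, 37]), (421, 156, [409]), (433, 176, [7, 59]),
     (439, 23, [13, 13, 2]), (443, 64, [7, 7, 7])]

/-- A certificate for the discriminant `-803591`. -/
def cert803591 : ThreeClassCert where
  B := 517
  m := 175
  a := 218
  k := 1479930
  b := 847
  l := -11252607
  i := 31974
  j := -34516
  base :=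
    [(2, 21849721765468248613829397858942979107141691042859674),
     (3, 31911943768269525350669609498502305910834466925050724933498375545061168608391841663)]
  rels :=
    [(23, -18, [2, 2, 3, 3, 3, 3, 3, 3, 3]), (97, -550, [2, 2, 2, 2, 2, 2, 3, 3, 3, 3]),
     (103, 557, [2, 2, 2, 3, 3, 3, 23]), (107, 357, [2, 2, 2, 2, 2, 2, 2, 2, 2, 2, 3]),
     (139, -1638, [2, 2, 2, 2, 2, 2, 2, 2, 3, 3, 3, 3]), (151, 517, [2, 2, 2, 2, 2, 97]),
     (181, -178, [2, 2, 3, 107]), (281, -1606, [2, 2, 2, 2, 2, 3, 103]),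
     (307, -880, [2, 3, 23, 23]), (331, 60, [2, 3, 103]), (347, 32, [2, 3, 97]),
     (379, 485, [2, 2, 2, 2, 2, 2, 2, 3, 3]), (439, 154, [2, 2, 2, 2, 2, 2, 2, 2, 2]),
     (499, 730, [2, 2, 2, 2, 2, 2, 23]), (5, 86, [2, 2, 3, 23, 151]),
     (7, -27, [2, 2, 2, 2, 2, 2, 2, 3, 3, 5, 5]), (11, -42, [2, 2, 3, 307, 5]),
     (13, 5, [2, 2, 2, 2, 2, 3, 23, 7]), (17, 57, [2, 2, 3, 7, 11, 13]),
     (29, 8, [2, 3, 3, 5, 7, 11]), (37, 3, [2, 3, 181, 5]), (41, 1, [2, 2, 5, 5, 7, 7]),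
     (43, 18, [2, 2, 2, 3, 3, 5, 13]), (59, -52, [2, 3, 23, 5, 5]), (71, 24, [2, 3, 11, 43]),
     (79, 23, [2, 3, 5, 5, 17]), (89, 20, [2, 3, 13, 29]), (109, 37, [2, 2, 2, 2, 2, 2, 29]),
     (131, 7, [2, 13, 59]), (173, 50, [2, 2, 2, 3, 7, 7]), (197, 6, [2, 2, 3, 5, 17]),
     (223, 102, [2, 2, 3, 79]), (233, 77, [2, 2, 2, 3, 37]), (239, 99, [2, 3, 3, 7, 7]),
     (241, 114, [2, 2, 2, 3, 37]), (263, 121, [2, 2, 5, 41]), (271, 48, [2, 3, 5, 5, 5]),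
     (283, 53, [2, 2, 2, 2, 3, 3, 5]), (317, 157, [2, 2, 2, 89]), (457, 13, [2, 2, 2, 5, 11]),
     (461, 139, [2, 239]), (491, 186, [2, 2, 2, 2, 2, 3, 5]), (509, 113, [2, 2, 3, 5, 7])]

/-- A certificate for the discriminant `-835707`. -/
def cert835707 : ThreeClassCert where
  B := 527
  m := 8
  a := 259
  k := -1930368
  b := 379
  l := 16331402
  i := -27754
  j := 10319
  base :=
    [(7, 706273), (17, 1778417281), (37, -1726160526397), (41, -1041704368614)]
  rels :=
    [(3, -380, [7, 7, 7, 7, 7, 7]), (43, -30, [7, 17, 41]), (47, -71, [37, 41, 3]),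
     (59, -226, [7, 17, 37]), (73, 373, [37, 3, 43]), (101, 107, [37, 59]), (109, -306, [47, 59]),
     (113, 21, [17, 109]), (137, -258, [7, 7, 41]), (139, 64, [7, 3, 73]), (151, 330, [7, 7, 43]),
     (157, 77, [37, 37]), (167, 699, [37, 113]), (173, 397, [7, 3, 101]), (191, -167, [7, 3, 59]),
     (197, -188, [7, 3, 59]), (211, 523, [7, 3, 109]), (233, -121, [7, 137]),
     (241, 4, [17, 17, 3]), (251, 12, [7, 7, 17]), (257, -212, [7, 3, 47]), (271, 40, [7, 37, 3]),
     (283, -552, [7, 7, 37]), (293, 72, [17, 43]), (313, -272, [7, 3, 43]), (317, 112, [3, 233]),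
     (331, -269, [3, 283]), (349, 109, [3, 211]), (353, 114, [17, 37]), (359, -317, [7, 41, 3]),
     (367, -217, [17, 41]), (379, -293, [7, 37, 3]), (409, 8, [7, 73]), (419, 31, [3, 167]),
     (431, 121, [3, 173]), (433, -349, [7, 109]), (449, -422, [7, 41, 3]), (457, 79, [3, 157]),
     (463, 28, [3, 151]), (467, 27, [449]), (499, 84, [433]), (509, 16, [3, 137])]

/-- A certificate for the discriminant `-999704`. -/
def cert999704 : ThreeClassCert where
  B := 577
  m := 46
  a := 63
  k := -11
  b := 2455
  l := 4384107107
  i := -36803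
  j := 63808
  base :=
    [(3, 1547139411765008658322), (5, 13407594437930351174054732938357),
     (7, -177985869092899497667974140571981705200),
     (11, -240148450870488939402624965476460196618498060049)]
  rels :=
    [(2, -172, [3, 5, 7, 11, 11, 11]), (13, 18, [5, 5, 5, 7, 11, 2]), (17, 73, [3, 5, 7, 11, 13]),
     (19, -38, [3, 3, 3, 5, 7, 7, 2]), (29, 5, [3, 13, 13, 17]), (37, -34, [3, 3, 2, 13, 29]),
     (41, 57, [5, 5, 13, 19]), (59, 82, [3, 5, 5, 2, 29]), (61, 150, [7, 11, 2, 29]),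
     (83, -53, [3, 5, 7, 29]), (97, 25, [3, 3, 7, 41]), (101, 7, [3, 3, 5, 5, 11]),
     (103, 40, [3, 11, 2, 37]), (113, 16, [3, 3, 3, 2, 41]), (137, 28, [3, 5, 2, 61]),
     (149, 29, [3, 3, 11, 17]), (193, 3, [5, 7, 37]), (199, 60, [7, 7, 2, 13]),
     (211, 98, [3, 5, 2, 41]), (227, -226, [3, 2, 13, 17]), (239, 32, [3, 5, 5, 7, 2]),
     (241, -192, [5, 7, 2, 17]), (257, -188, [3, 5, 2, 37]), (263, 72, [5, 2, 97]),
     (269, 128, [3, 3, 5, 11, 2]), (283, 23, [3, 5, 59]), (313, 133, [3, 3, 5, 19]),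
     (337, 129, [7, 113]), (347, -221, [3, 7, 41]), (349, 49, [3, 241]), (353, 46, [3, 7, 2, 17]),
     (359, 80, [3, 7, 2, 17]), (367, 1, [3, 227]), (373, 43, [3, 3, 3, 5, 5]),
     (383, 126, [2, 347]), (401, 52, [3, 3, 5, 7, 2]), (409, 88, [3, 3, 5, 7, 2]),
     (431, 47, [3, 3, 5, 13]), (439, 83, [3, 3, 5, 13]), (443, 66, [7, 2, 41]),
     (449, 166, [3, 2, 103]), (461, 77, [3, 5, 37]), (463, 179, [3, 7, 29]),
     (479, 152, [3, 5, 2, 19]), (487, 187, [3, 3, 5, 13]), (491, 22, [3, 5, 2, 17]),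
     (499, 155, [3, 3, 61]), (523, 157, [3, 5, 5, 7]), (541, 4, [3, 7, 11, 2]),
     (547, 193, [3, 5, 5, 7]), (557, -296, [3, 2, 101]), (571, 261, [557])]

open NumberField in
theorem nonempty_sylow_of_check {d : ℤ} (ε n : ℤ) (c : ThreeClassCert)
    (h : (d == ε * ε - 4 * n && isFundamental d && c.check ε n) = true)
    {K : Type*} [Field K] [NumberField K] (hK : Module.finrank ℚ K = 2) {α : K}
    (hα : α ^ 2 = (d : K)) (P : Sylow 3 (ClassGroup (𝓞 K))) :
    Nonempty (P ≃* Multiplicative (ZMod 3 × ZMod 3)) := by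
  simp only [Bool.and_eq_true, beq_iff_eq] at h
  obtain ⟨⟨rfl, hf⟩, hc⟩ := h
  obtain ⟨ω, hω⟩ := exists_isImagQuadOrder hK hα hf
  exact hω.nonempty_sylow_mulEquiv hc P

/-- For each discriminant `d` in the given list, every imaginary quadratic
field `ℚ(√d)` (i.e. every degree-2 number field containing a square root of
`d`; note `d < 0` forces the field to be imaginary) has 3-class group — the
Sylow 3-subgroup of the ideal class group of its ring of integers —
isomorphic to `Multiplicative (ZMod 3 × ZMod 3)` (of order 9). -/
theorem three_class_group_stmt15 :
    ∀ d : ℤ, d ∈ ({-291220, -633352, -874680, -731867, -507140, -578847, -167064, -296407, -317747, -401603, -588027, -591412, -803591, -835707, -999704} : Set ℤ) →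
    ∀ (K : Type) [inst : Field K] [inst2 : NumberField K],
      Module.finrank ℚ K = 2 → (∃ α : K, α ^ 2 = (d : K)) →
      ∀ P : Sylow 3 (ClassGroup (NumberField.RingOfIntegers K)),
        Nonempty (↥P ≃* Multiplicative (ZMod 3 × ZMod 3)) := by
  intro d hd K _ _ hK ⟨α, hα⟩ P
  simp only [Set.mem_insert_iff, Set.mem_singleton_iff] at hd
  rcases hd with
    rfl | rfl | rfl | rfl | rfl | rfl | rfl | rfl | rfl | rfl | rfl | rfl | rfl | rfl | rfl
  · exact nonempty_sylow_of_check 0 72805 cert291220 (by decide +kernel) hK hα P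
  · exact nonempty_sylow_of_check 0 158338 cert633352 (by decide +kernel) hK hα P
  · exact nonempty_sylow_of_check 0 218670 cert874680 (by decide +kernel) hK hα P
  · exact nonempty_sylow_of_check 1 182967 cert731867 (by decide +kernel) hK hα P
  · exact nonempty_sylow_of_check 0 126785 cert507140 (by decide +kernel) hK hα P
  · exact nonempty_sylow_of_check 1 144712 cert578847 (by decide +kernel) hK hα P
  · exact nonempty_sylow_of_check 0 41766 cert167064 (by decide +kernel) hK hα P
  · exact nonempty_sylow_of_check 1 74102 cert296407 (by decide +kernel) hK hα P
  · exact nonempty_sylow_of_check 1 79437 cert317747 (by decide +kernel) hK hα P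
  · exact nonempty_sylow_of_check 1 100401 cert401603 (by decide +kernel) hK hα P
  · exact nonempty_sylow_of_check 1 147007 cert588027 (by decide +kernel) hK hα P
  · exact nonempty_sylow_of_check 0 147853 cert591412 (by decide +kernel) hK hα P
  · exact nonempty_sylow_of_check 1 200898 cert803591 (by decide +kernel) hK hα P
  · exact nonempty_sylow_of_check 1 208927 cert835707 (by decide +kernel) hK hα P
  · exact nonempty_sylow_of_check 0 249926 cert999704 (by decide +kernel) hK hα P
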